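/- There are exactly 27240 (3,7) pseudo-GCOs on the label set {1,…,7}, and the relabeling action of the symmetric group S_7 on them has exactly 11 orbits. -/

import Mathlib

/-- Dihedral equivalence of lists: `l₂` is obtained from `l₁` by a rotation,
possibly composed with a reversal.  Two cyclic words represent the same
(2,m) color ordering iff they are dihedrally equivalent. -/
def DihEquiv {α : Type*} (l₁ l₂ : List α) : Prop :=
  List.IsRotated l₁ l₂ ∨ List.IsRotated l₁.reverse l₂

theorem dihEquiv_refl {α : Type*} (l : List α) : DihEquiv l l :=
  Or.inl (List.IsRotated.refl l)

theorem dihEquiv_symm {α : Type*} {l₁ l₂ : List α} (h : DihEquiv l₁ l₂) : DihEquiv l₂ l₁ := by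
  rcases h with h | h
  · exact Or.inl h.symm
  · have h2 := h.reverse
    rw [List.reverse_reverse] at h2
    exact Or.inr h2.symm

theorem dihEquiv_trans {α : Type*} {l₁ l₂ l₃ : List α} (h : DihEquiv l₁ l₂)
    (h' : DihEquiv l₂ l₃) : DihEquiv l₁ l₃ := by
  rcases h with h | h <;> rcases h' with h' | h'
  · exact Or.inl (h.trans h')
  · exact Or.inr (h.reverse.trans h')
  · exact Or.inr (h.trans h')
  · have h2 := h.reverse
    rw [List.reverse_reverse] at h2
    exact Or.inl (h2.trans h')

/-- A `(k, S.card)` pre-GCO on the label set `S`, given by representatives: to every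
`(k-2)`-element subset `I ⊆ S` it assigns a cyclic word on `S \ I` (a representative of
a `(2, S.card - k + 2)` color ordering).  Values of `σ` on other subsets are irrelevant. -/
def IsPreGCO (k : ℕ) (S : Finset ℕ) (σ : Finset ℕ → List ℕ) : Prop :=
  ∀ I : Finset ℕ, I ⊆ S → I.card = k - 2 →
    (σ I).Nodup ∧ (σ I).toFinset = S \ I

/-- The recursive pseudo-GCO condition on a `(k, S.card)` pre-GCO (given by
representatives).  For `S.card = k + 2` it says that the pre-GCO is the descendant of a
`(2, k+2)` color ordering (represented by `base`); for `S.card > k + 2` it requires all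
`k`-preserving projections (delete the component at subsets containing `i`, and delete
the label `i` from the remaining components) to be pseudo-GCOs. -/
def IsPseudoGCO (k : ℕ) (S : Finset ℕ) (σ : Finset ℕ → List ℕ) : Prop :=
  if S.card ≤ k + 2 then
    ∃ base : List ℕ, base.Nodup ∧ base.toFinset = S ∧
      ∀ I : Finset ℕ, I ⊆ S → I.card = k - 2 →
        DihEquiv (σ I) (base.filter (fun x => x ∉ I))
  else
    ∀ i ∈ S, IsPseudoGCO k (S.erase i) (fun I => (σ I).filter (fun x => x ≠ i))
termination_by S.card
decreasing_by exact Finset.card_erase_lt_of_mem ‹_›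

/-- Setoid identifying two `(k, S.card)` pre-GCO representatives when all of their
relevant components are dihedrally equivalent, i.e. when they represent the same
generalized color ordering. -/
def gcoSetoid (k : ℕ) (S : Finset ℕ) (P : (Finset ℕ → List ℕ) → Prop) :
    Setoid {σ : Finset ℕ → List ℕ // P σ} where
  r σ τ := ∀ I : Finset ℕ, I ⊆ S → I.card = k - 2 → DihEquiv (σ.1 I) (τ.1 I)
  iseqv :=
    ⟨fun σ I _ _ => dihEquiv_refl (σ.1 I),
     fun h I hI hc => dihEquiv_symm (h I hI hc),
     fun h h' I hI hc => dihEquiv_trans (h I hI hc) (h' I hI hc)⟩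

theorem dihEquiv_map {α β : Type*} (f : α → β) {l₁ l₂ : List α} (h : DihEquiv l₁ l₂) :
    DihEquiv (l₁.map f) (l₂.map f) := by
  rcases h with h | h
  · exact Or.inl (h.map f)
  · right
    have h2 := h.map f
    rw [List.map_reverse] at h2
    exact h2

/-- Relabeling relation on `(k, S.card)` pre-GCO representatives: `τ` is obtained from
`σ` by a permutation `ρ` of the label set `S`, which sends the component at `I` to the
component at the image of `I`, relabeled by `ρ`. -/
def RelabelRel (k : ℕ) (S : Finset ℕ) (σ τ : Finset ℕ → List ℕ) : Prop :=
  ∃ ρ : Equiv.Perm ℕ, (∀ x : ℕ, x ∈ S ↔ ρ x ∈ S) ∧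
    ∀ I : Finset ℕ, I ⊆ S → I.card = k - 2 →
      DihEquiv ((σ (I.image ρ.symm)).map ρ) (τ I)

theorem relabelRel_refl (k : ℕ) (S : Finset ℕ) (σ : Finset ℕ → List ℕ) :
    RelabelRel k S σ σ :=
  ⟨Equiv.refl ℕ, fun _ => Iff.rfl, fun I _ _ => by simpa using dihEquiv_refl (σ I)⟩

theorem relabelRel_symm {k : ℕ} {S : Finset ℕ} {σ τ : Finset ℕ → List ℕ}
    (h : RelabelRel k S σ τ) : RelabelRel k S τ σ := by
  obtain ⟨ρ, hmem, hcomp⟩ := h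
  refine ⟨ρ.symm, fun x => ?_, fun I hI hc => ?_⟩
  · have := hmem (ρ.symm x)
    simpa using this.symm
  · have hI' : I.image ρ ⊆ S := by
      intro x hx
      obtain ⟨y, hy, rfl⟩ := Finset.mem_image.mp hx
      exact (hmem y).mp (hI hy)
    have hc' : (I.image ρ).card = k - 2 := by
      rw [Finset.card_image_of_injective _ ρ.injective]; exact hc
    have h1 := hcomp (I.image ρ) hI' hc'
    have hII : (I.image ρ).image ρ.symm = I := by
      rw [Finset.image_image]
      simp
    rw [hII] at h1
    have h2 := dihEquiv_map ρ.symm (dihEquiv_symm h1)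
    have h3 : ((σ I).map ρ).map ρ.symm = σ I := by
      rw [List.map_map]
      simp
    rw [h3] at h2
    simpa using h2

theorem relabelRel_trans {k : ℕ} {S : Finset ℕ} {σ τ υ : Finset ℕ → List ℕ}
    (h : RelabelRel k S σ τ) (h' : RelabelRel k S τ υ) : RelabelRel k S σ υ := by
  obtain ⟨ρ, hmem, hcomp⟩ := h
  obtain ⟨ρ', hmem', hcomp'⟩ := h'
  refine ⟨ρ.trans ρ', fun x => (hmem x).trans (hmem' (ρ x)), fun I hI hc => ?_⟩
  have hI₁ : I.image ρ'.symm ⊆ S := by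
    intro x hx
    obtain ⟨y, hy, rfl⟩ := Finset.mem_image.mp hx
    have := hmem' (ρ'.symm y)
    simp only [Equiv.apply_symm_apply] at this
    exact this.mpr (hI hy)
  have hc₁ : (I.image ρ'.symm).card = k - 2 := by
    rw [Finset.card_image_of_injective _ ρ'.symm.injective]; exact hc
  have h1 := hcomp (I.image ρ'.symm) hI₁ hc₁
  have h2 := dihEquiv_map ρ' h1
  have h3 := hcomp' I hI hc
  have key : ((σ (((I.image ρ'.symm)).image ρ.symm)).map ρ).map ρ' =
      (σ (I.image (ρ.trans ρ').symm)).map (ρ.trans ρ') := by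
    rw [List.map_map, Finset.image_image]
    rfl
  rw [key] at h2
  exact dihEquiv_trans h2 h3

/-- Setoid whose classes are the orbits of the relabeling action of the symmetric group
of `S` on generalized color orderings. -/
def gcoOrbitSetoid (k : ℕ) (S : Finset ℕ) (P : (Finset ℕ → List ℕ) → Prop) :
    Setoid {σ : Finset ℕ → List ℕ // P σ} where
  r σ τ := RelabelRel k S σ.1 τ.1
  iseqv := ⟨fun σ => relabelRel_refl k S σ.1, relabelRel_symm, relabelRel_trans⟩

/-- The natural projection sending a generalized color ordering to its relabeling
orbit. -/
def toOrbit (k : ℕ) (S : Finset ℕ) (P : (Finset ℕ → List ℕ) → Prop) :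
    Quotient (gcoSetoid k S P) → Quotient (gcoOrbitSetoid k S P) :=
  Quotient.map' id (fun σ τ h =>
    ⟨Equiv.refl ℕ, fun x => Iff.rfl, fun I hI hc => by simpa using h I hI hc⟩)

/-! ### Dihedral equivalence of words -/

section Words

variable {α : Type*}

theorem DihEquiv.perm {l l' : List α} (h : DihEquiv l l') : l.Perm l' :=
  h.elim List.IsRotated.perm fun h => l.reverse_perm.symm.trans h.perm

theorem List.IsRotated.filter {l l' : List α} (p : α → Bool) (h : l.IsRotated l') :
    (l.filter p).IsRotated (l'.filter p) := by
  obtain ⟨n, rfl⟩ := h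
  rw [List.rotate_eq_drop_append_take_mod, List.filter_append]
  conv_lhs => rw [← List.take_append_drop (n % l.length) l, List.filter_append]
  exact List.isRotated_append

theorem DihEquiv.filter {l l' : List α} (p : α → Bool) (h : DihEquiv l l') :
    DihEquiv (l.filter p) (l'.filter p) :=
  h.imp (fun h => h.filter p) fun h => by simpa using h.filter p

/-- All words dihedrally equivalent to a given one. -/
def dihedralWords (l : List α) : List (List α) :=
  l.cyclicPermutations ++ l.reverse.cyclicPermutations

theorem mem_dihedralWords {l l' : List α} : l' ∈ dihedralWords l ↔ DihEquiv l l' := by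
  simp only [dihedralWords, List.mem_append, List.mem_cyclicPermutations_iff, DihEquiv]
  exact or_congr ⟨.symm, .symm⟩ ⟨.symm, .symm⟩

instance [DecidableEq α] (l l' : List α) : Decidable (DihEquiv l l') :=
  decidable_of_iff _ mem_dihedralWords

theorem List.IsRotated.eq_of_nodup_cons {m : α} {t t' : List α} (hn : (m :: t).Nodup)
    (h : (m :: t).IsRotated (m :: t')) : t = t' := by
  obtain ⟨n, hlt, hn'⟩ := List.isRotated_iff_mod.mp h
  rcases Nat.eq_zero_or_pos n with rfl | hpos
  · simpa using hn'
  rcases hlt.lt_or_eq with hlt | rfl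
  · have h0 : ((m :: t).rotate n)[0]? = some m := by rw [hn']; rfl
    rw [List.getElem?_rotate (by simp), Nat.zero_add, Nat.mod_eq_of_lt hlt,
      List.getElem?_eq_getElem hlt, Option.some_inj] at h0
    have := (hn.getElem_inj_iff (hi := hlt) (hj := by simp)).mp
      (h0.trans (List.getElem_cons_zero ..).symm)
    omega
  · simpa using hn'

theorem DihEquiv.eq_or_eq_reverse {m : α} {t t' : List α} (hn : (m :: t).Nodup)
    (h : DihEquiv (m :: t) (m :: t')) : t = t' ∨ t.reverse = t' := by
  refine h.imp (fun h => h.eq_of_nodup_cons hn) fun h => ?_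
  have hr : (m :: t.reverse).IsRotated (m :: t') := by
    refine List.IsRotated.trans ?_ h
    rw [List.reverse_cons]
    exact List.isRotated_append (l := [m])
  exact hr.eq_of_nodup_cons (by simpa using hn)

end Words

/-! ### Canonical representatives -/

/-- The word `l` or its reversal, whichever has the smaller first letter. -/
def orient (l : List ℕ) : List ℕ :=
  bif Nat.ble (l.headD 0) (l.getLastD 0) then l else l.reverse

theorem orient_eq_or (l : List ℕ) : orient l = l ∨ orient l = l.reverse := by
  unfold orient
  cases Nat.ble (l.headD 0) (l.getLastD 0)
  · exact Or.inr rfl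
  · exact Or.inl rfl

theorem ble_orient (l : List ℕ) :
    Nat.ble ((orient l).headD 0) ((orient l).getLastD 0) = true := by
  cases h : Nat.ble (l.headD 0) (l.getLastD 0)
  · simp only [orient, h, cond_false]
    rw [← Bool.not_eq_true, Nat.ble_eq] at h
    simp only [Nat.ble_eq, List.getLastD_eq_getLast?, List.headD_eq_head?_getD,
      List.getLast?_reverse, List.head?_reverse] at h ⊢
    omega
  · simp only [orient, h, cond_true]

/-- The canonical form, starting with the letter `m`, of the cyclic word `acc.reverse ++ l`,
where `m` is expected in `l`. -/
def canonAux (m : ℕ) (acc : List ℕ) : List ℕ → List ℕ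
  | [] => []
  | x :: l => bif Nat.beq x m then m :: orient (l ++ acc.reverse) else canonAux m (x :: acc) l

/-- The canonical form, starting with the letter `m`, of the cyclic word `l`. -/
def canon (m : ℕ) (l : List ℕ) : List ℕ := canonAux m [] l

theorem dihEquiv_cons_orient (m : ℕ) (t : List ℕ) : DihEquiv (m :: t) (m :: orient t) := by
  rcases orient_eq_or t with h | h <;> rw [h]
  · exact dihEquiv_refl _
  · right
    rw [List.reverse_cons]
    exact List.isRotated_append (l' := [m])

theorem dihEquiv_canonAux {m : ℕ} {l : List ℕ} (h : m ∈ l) (acc : List ℕ) :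
    DihEquiv (acc.reverse ++ l) (canonAux m acc l) ∧
      ∃ t, canonAux m acc l = m :: orient t := by
  induction l generalizing acc with
  | nil => simp at h
  | cons x l ih =>
    by_cases hx : x = m
    · subst hx
      simp only [canonAux, Nat.beq_refl, cond_true]
      exact ⟨dihEquiv_trans (Or.inl List.isRotated_append) (dihEquiv_cons_orient _ _), _, rfl⟩
    · have hb : Nat.beq x m = false := by
        rwa [← Bool.not_eq_true, Nat.beq_eq]
      simp only [canonAux, hb, cond_false]
      simpa using ih ((List.mem_cons.mp h).resolve_left (Ne.symm hx)) (x :: acc)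

theorem dihEquiv_canon {m : ℕ} {l : List ℕ} (h : m ∈ l) : DihEquiv l (canon m l) :=
  (dihEquiv_canonAux h []).1

/-- The canonical representatives of the `(2, m)` color orderings on the letters of a word. -/
def colorOrderings : List ℕ → List (List ℕ)
  | [] => []
  | m :: t =>
    (t.permutations'.filter fun t => Nat.ble (t.headD 0) (t.getLastD 0)).map (m :: ·)

theorem canon_mem_colorOrderings {m : ℕ} {t l : List ℕ} (h : l.Perm (m :: t)) :
    canon m l ∈ colorOrderings (m :: t) := by
  obtain ⟨hd, u, hu⟩ := dihEquiv_canonAux (h.mem_iff.mpr List.mem_cons_self) []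
  have hp : (m :: orient u).Perm (m :: t) := hu ▸ hd.perm.symm.trans h
  rw [canon, hu, colorOrderings]
  exact List.mem_map_of_mem (List.mem_filter.mpr
    ⟨List.mem_permutations'.mpr ((List.perm_cons m).mp hp), ble_orient u⟩)

theorem perm_of_mem_colorOrderings {s l : List ℕ} (h : l ∈ colorOrderings s) : l.Perm s := by
  cases s with
  | nil => simp [colorOrderings] at h
  | cons m t =>
    obtain ⟨u, hu, rfl⟩ := List.mem_map.mp h
    exact (List.mem_permutations'.mp (List.mem_filter.mp hu).1).cons m

theorem nodup_colorOrderings {s : List ℕ} (h : s.Nodup) : (colorOrderings s).Nodup := by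
  cases s with
  | nil => simp [colorOrderings]
  | cons m t =>
    exact (((List.permutations_perm_permutations' t).nodup_iff.mp
      (List.nodup_permutations _ h.of_cons)).filter _).map (List.cons_injective)

theorem DihEquiv.eq_of_mem_colorOrderings {s l l' : List ℕ} (hs : s.Nodup)
    (hl : l ∈ colorOrderings s) (hl' : l' ∈ colorOrderings s) (h : DihEquiv l l') : l = l' := by
  have hn := (perm_of_mem_colorOrderings hl).nodup_iff.mpr hs
  cases s with
  | nil => simp [colorOrderings] at hl
  | cons m t =>
    obtain ⟨u, hu, rfl⟩ := List.mem_map.mp hl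
    obtain ⟨u', hu', rfl⟩ := List.mem_map.mp hl'
    rcases h.eq_or_eq_reverse hn with rfl | rfl
    · rfl
    have h1 := (List.mem_filter.mp hu).2
    have h2 := (List.mem_filter.mp hu').2
    simp only [Nat.ble_eq, List.getLastD_eq_getLast?, List.headD_eq_head?_getD,
      List.getLast?_reverse, List.head?_reverse] at h1 h2
    cases u with
    | nil => rfl
    | cons x u =>
      cases u using List.reverseRecOn with
      | nil => rfl
      | append_singleton u y =>
        simp only [List.head?_cons, Option.getD_some] at h1 h2
        rw [← List.cons_append, List.getLast?_concat, Option.getD_some] at h1 h2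
        have hxy : x = y := le_antisymm h1 h2
        simp [hxy] at hn

/-! ### Relabeling -/

/-- The relabeling of a pre-GCO by a permutation of the labels. -/
def relabel (ρ : Equiv.Perm ℕ) (σ : Finset ℕ → List ℕ) (I : Finset ℕ) : List ℕ :=
  (σ (I.image ρ.symm)).map ρ

theorem filter_ne_map (ρ : Equiv.Perm ℕ) (i : ℕ) (l : List ℕ) :
    (l.map ρ).filter (fun x => x ≠ ρ i) = (l.filter fun x => x ≠ i).map ρ := by
  rw [List.filter_map]
  congr 2
  ext x
  simp

theorem IsPseudoGCO.of_relabel {k : ℕ} {S : Finset ℕ} {σ τ : Finset ℕ → List ℕ}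
    (ρ : Equiv.Perm ℕ)
    (h : ∀ I ⊆ S.image ρ, I.card = k - 2 → DihEquiv (relabel ρ σ I) (τ I))
    (hσ : IsPseudoGCO k S σ) : IsPseudoGCO k (S.image ρ) τ := by
  induction hS : S.card using Nat.strong_induction_on generalizing S σ τ with
  | _ n ih =>
  subst hS
  have hcard (I : Finset ℕ) (π : Equiv.Perm ℕ) : (I.image π).card = I.card :=
    Finset.card_image_of_injective _ π.injective
  rw [IsPseudoGCO] at hσ ⊢
  rw [hcard]
  split_ifs at hσ ⊢ with hk
  · obtain ⟨b, hb, hbS, hbI⟩ := hσ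
    refine ⟨b.map ρ, hb.map ρ.injective, ?_, fun I hI hIc => ?_⟩
    · ext x
      simp [← hbS]
    · refine dihEquiv_trans (dihEquiv_symm (h I hI hIc)) ?_
      have hsub : I.image ρ.symm ⊆ S := by
        intro x hx
        obtain ⟨y, hy, rfl⟩ := Finset.mem_image.mp hx
        obtain ⟨z, hz, rfl⟩ := Finset.mem_image.mp (hI hy)
        simpa using hz
      have := dihEquiv_map ρ (hbI _ hsub ((hcard _ _).trans hIc))
      refine (congrArg _ ?_).mp this
      rw [List.filter_map]
      congr 2
      ext x
      simp [Equiv.symm_apply_eq]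
  · intro j hj
    obtain ⟨i, hi, rfl⟩ := Finset.mem_image.mp hj
    rw [← Finset.image_erase ρ.injective]
    refine ih _ (Finset.card_erase_lt_of_mem hi) (fun I hI hIc => ?_) (hσ i hi) rfl
    rw [relabel, ← filter_ne_map]
    exact (h I (hI.trans (Finset.image_subset_image (Finset.erase_subset _ _))) hIc).filter _

theorem image_eq_of_mem_iff {S : Finset ℕ} {ρ : Equiv.Perm ℕ} (h : ∀ x, x ∈ S ↔ ρ x ∈ S) :
    S.image ρ = S := by
  ext x
  simp only [Finset.mem_image]
  exact ⟨fun ⟨y, hy, hx⟩ => hx ▸ (h y).mp hy,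
    fun hx => ⟨ρ.symm x, (h _).mpr (by simpa using hx), by simp⟩⟩

theorem RelabelRel.isPreGCO {k : ℕ} {S : Finset ℕ} {σ τ : Finset ℕ → List ℕ}
    (h : RelabelRel k S σ τ) (hσ : IsPreGCO k S σ) : IsPreGCO k S τ := by
  obtain ⟨ρ, hρ, h⟩ := h
  intro I hI hIc
  have hp := (h I hI hIc).perm
  have hS := image_eq_of_mem_iff hρ
  obtain ⟨hn, hf⟩ := hσ (I.image ρ.symm) (fun x hx => by
    obtain ⟨y, hy, rfl⟩ := Finset.mem_image.mp hx
    exact (hρ _).mpr (by simpa using hI hy))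
    ((Finset.card_image_of_injective _ ρ.symm.injective).trans hIc)
  refine ⟨hp.nodup_iff.mp (hn.map ρ.injective), ?_⟩
  rw [← List.toFinset_eq_of_perm _ _ hp]
  ext x
  have := congrArg (ρ.symm x ∈ ·) hf
  simp only [List.mem_toFinset, Finset.mem_sdiff, Finset.mem_image,
    ρ.symm.injective.eq_iff, exists_eq_right, eq_iff_iff] at this
  have hx := hρ (ρ.symm x)
  rw [Equiv.apply_symm_apply] at hx
  rw [Finset.mem_sdiff, ← hx, ← this, List.mem_toFinset, List.mem_map]
  exact ⟨fun ⟨a, ha, hax⟩ => by rwa [← hax, Equiv.symm_apply_apply],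
    fun h => ⟨_, h, ρ.apply_symm_apply x⟩⟩

theorem RelabelRel.isPseudoGCO {k : ℕ} {S : Finset ℕ} {σ τ : Finset ℕ → List ℕ}
    (h : RelabelRel k S σ τ) (hσ : IsPseudoGCO k S σ) : IsPseudoGCO k S τ := by
  obtain ⟨ρ, hρ, h⟩ := h
  have hS := image_eq_of_mem_iff hρ
  exact hS ▸ hσ.of_relabel ρ fun I hI => h I (hS ▸ hI)

theorem relabelRel_relabel {ρ : Equiv.Perm ℕ} {S : Finset ℕ} (hρ : ∀ x, x ∈ S ↔ ρ x ∈ S)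
    (k : ℕ) (σ : Finset ℕ → List ℕ) : RelabelRel k S σ (relabel ρ σ) :=
  ⟨ρ, hρ, fun _ _ _ => dihEquiv_refl _⟩

theorem relabel_singleton (ρ : Equiv.Perm ℕ) (σ : Finset ℕ → List ℕ) (i : ℕ) :
    relabel ρ σ {ρ i} = (σ {i}).map ρ := by
  simp [relabel]

/-- A self-map of a finite set of labels that is onto extends to a permutation of all labels. -/
theorem exists_perm_of_surjOn {S : Finset ℕ} {f : ℕ → ℕ} (hf : ∀ y ∈ S, ∃ x ∈ S, f x = y) :
    ∃ ρ : Equiv.Perm ℕ, (∀ x, x ∈ S ↔ ρ x ∈ S) ∧ ∀ x ∈ S, ρ x = f x := by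
  have hS : S.image f = S := by
    refine (Finset.eq_of_subset_of_card_le (fun y hy => ?_) Finset.card_image_le).symm
    obtain ⟨x, hx, rfl⟩ := hf y hy
    exact Finset.mem_image_of_mem f hx
  have hmaps (x : S) : f x ∈ S :=
    hS.subset (Finset.mem_image_of_mem f x.2)
  have hsurj : Function.Surjective fun x : S => (⟨f x, hmaps x⟩ : S) := by
    rintro ⟨y, hy⟩
    obtain ⟨x, hx, rfl⟩ := hf y hy
    exact ⟨⟨x, hx⟩, rfl⟩
  let e : Equiv.Perm S := Equiv.ofBijective _ (Finite.surjective_iff_bijective.mp hsurj)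
  refine ⟨Equiv.Perm.ofSubtype e, fun x => (Equiv.Perm.ofSubtype_apply_mem_iff_mem e x).symm,
    fun x hx => ?_⟩
  rw [Equiv.Perm.ofSubtype_apply_of_mem e hx]
  rfl

theorem canon_headD_mem {s l : List ℕ} (hs : s ≠ []) (h : l.Perm s) :
    canon (s.headD 0) l ∈ colorOrderings s ∧ DihEquiv l (canon (s.headD 0) l) := by
  cases s with
  | nil => exact absurd rfl hs
  | cons m t =>
    exact ⟨canon_mem_colorOrderings h, dihEquiv_canon (h.mem_iff.mpr List.mem_cons_self)⟩

/-- The word `l` with the letter `i` deleted. -/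
def del (i : ℕ) (l : List ℕ) : List ℕ := l.filter fun x => !Nat.beq x i

theorem del_eq_filter (i : ℕ) (l : List ℕ) : del i l = l.filter fun x => x ≠ i :=
  List.filter_congr fun x _ => by rw [Bool.eq_iff_iff]; simp [← Bool.not_eq_true, Nat.beq_eq]

theorem mem_del {i x : ℕ} {l : List ℕ} : x ∈ del i l ↔ x ∈ l ∧ x ≠ i := by
  simp [del_eq_filter]

theorem DihEquiv.del {l l' : List ℕ} (h : DihEquiv l l') (i : ℕ) :
    DihEquiv (del i l) (del i l') :=
  h.filter _

theorem del_map (ρ : Equiv.Perm ℕ) (i : ℕ) (l : List ℕ) :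
    del (ρ i) (l.map ρ) = (del i l).map ρ := by
  simp only [del_eq_filter, filter_ne_map]

/-! ### Pseudo-GCOs on seven labels -/

def labels : List ℕ := [1, 2, 3, 4, 5, 6, 7]

theorem mem_labels {i : ℕ} : i ∈ labels ↔ i ∈ Finset.Icc 1 7 := by
  rw [show Finset.Icc 1 7 = labels.toFinset by decide, List.mem_toFinset]

/-- The property of being (a system of representatives of) a `(3,7)` pseudo-GCO. -/
def IsGCO (σ : Finset ℕ → List ℕ) : Prop :=
  IsPreGCO 3 (Finset.Icc 1 7) σ ∧ IsPseudoGCO 3 (Finset.Icc 1 7) σ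

theorem RelabelRel.isGCO {σ τ : Finset ℕ → List ℕ} (h : RelabelRel 3 (Finset.Icc 1 7) σ τ)
    (hσ : IsGCO σ) : IsGCO τ :=
  ⟨h.isPreGCO hσ.1, h.isPseudoGCO hσ.2⟩

theorem forall_subset_card_one {S : Finset ℕ} {P : Finset ℕ → Prop} :
    (∀ I ⊆ S, I.card = 3 - 2 → P I) ↔ ∀ i ∈ S, P {i} := by
  refine ⟨fun h i hi => h _ (by simpa using hi) (by simp), fun h I hI hc => ?_⟩
  obtain ⟨i, rfl⟩ := Finset.card_eq_one.mp hc
  exact h i (by simpa using hI)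

/-- The pairs of labels whose complements are the five-element subsets of `labels`. -/
def pairs : List (ℕ × ℕ) :=
  [(6, 7), (5, 7), (5, 6), (4, 7), (4, 6), (4, 5), (3, 7), (3, 6), (3, 5), (3, 4), (2, 7),
    (2, 6), (2, 5), (2, 4), (2, 3), (1, 7), (1, 6), (1, 5), (1, 4), (1, 3), (1, 2)]

/-- The complement of a pair of labels. -/
def quint (p : ℕ × ℕ) : List ℕ := del p.2 (del p.1 labels)

theorem mem_quint {p : ℕ × ℕ} {a : ℕ} : a ∈ quint p ↔ (a ∈ labels ∧ a ≠ p.1) ∧ a ≠ p.2 := by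
  rw [quint, mem_del, mem_del]

theorem nodup_quint (p : ℕ × ℕ) : (quint p).Nodup :=
  .filter _ (.filter _ (by decide))

/-- The components `x i`, restricted to the complement of `p`, descend from a single
`(2,5)` color ordering. -/
def Descends (x : ℕ → List ℕ) (p : ℕ × ℕ) : Prop :=
  ∃ b ∈ colorOrderings (quint p), ∀ a ∈ quint p, DihEquiv (del p.2 (del p.1 (x a))) (del a b)

theorem isPseudoGCO_three_five_iff {i j : ℕ} (hi : i ∈ Finset.Icc 1 7)
    (hj : j ∈ (Finset.Icc 1 7).erase i) {σ : Finset ℕ → List ℕ} :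
    IsPseudoGCO 3 (((Finset.Icc 1 7).erase i).erase j)
      (fun I => ((σ I).filter fun x => x ≠ i).filter fun x => x ≠ j) ↔
      Descends (fun a => σ {a}) (i, j) := by
  have hcard : (((Finset.Icc 1 7).erase i).erase j).card = 5 := by
    rw [Finset.card_erase_of_mem hj, Finset.card_erase_of_mem hi]
    rfl
  have hq : (quint (i, j)).toFinset = ((Finset.Icc 1 7).erase i).erase j := by
    ext a
    simp only [List.mem_toFinset, mem_quint, mem_labels, Finset.mem_erase]
    tauto
  have hne : quint (i, j) ≠ [] := by
    rintro h
    rw [← hq, h] at hcard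
    simp at hcard
  have hmem (a : ℕ) : a ∈ ((Finset.Icc 1 7).erase i).erase j ↔ a ∈ quint (i, j) := by
    rw [← hq, List.mem_toFinset]
  rw [IsPseudoGCO, if_pos (by rw [hcard])]
  simp only [forall_subset_card_one, hmem, Finset.mem_singleton, ← del_eq_filter, Descends]
  constructor
  · rintro ⟨b, hb, hbS, h⟩
    have hp : b.Perm (quint (i, j)) :=
      (List.perm_ext_iff_of_nodup hb (nodup_quint _)).mpr fun a => by
        rw [← List.mem_toFinset, ← List.mem_toFinset, hbS, hq]
    obtain ⟨hc, hd⟩ := canon_headD_mem hne hp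
    exact ⟨_, hc, fun a ha => dihEquiv_trans (h a ha) (hd.del a)⟩
  · rintro ⟨b, hb, h⟩
    have hp := perm_of_mem_colorOrderings hb
    exact ⟨b, hp.nodup_iff.mpr (nodup_quint _), (List.toFinset_eq_of_perm _ _ hp).trans hq, h⟩

theorem isPseudoGCO_three_seven_iff {σ : Finset ℕ → List ℕ} :
    IsPseudoGCO 3 (Finset.Icc 1 7) σ ↔ ∀ p ∈ pairs, Descends (fun a => σ {a}) p := by
  have hcard {i : ℕ} (hi : i ∈ Finset.Icc 1 7) : ((Finset.Icc 1 7).erase i).card = 6 := by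
    rw [Finset.card_erase_of_mem hi]
    rfl
  have hpairs : ∀ p ∈ pairs, p.1 ∈ labels ∧ p.2 ∈ labels ∧ p.2 ≠ p.1 := by decide
  have hsymm : ∀ i ∈ labels, ∀ j ∈ labels, j ≠ i → (i, j) ∈ pairs ∨ (j, i) ∈ pairs := by decide
  have hcomm (i j : ℕ) (l : List ℕ) : del i (del j l) = del j (del i l) := List.filter_comm ..
  rw [IsPseudoGCO, if_neg (by decide)]
  constructor
  · intro h p hp
    obtain ⟨h1, h2, hne⟩ := hpairs p hp
    rw [mem_labels] at h1 h2
    have hj := Finset.mem_erase.mpr ⟨hne, h2⟩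
    have := h p.1 h1
    rw [IsPseudoGCO, if_neg (by rw [hcard h1]; decide)] at this
    exact (isPseudoGCO_three_five_iff h1 hj).mp (this p.2 hj)
  · intro h i hi
    rw [IsPseudoGCO, if_neg (by rw [hcard hi]; decide)]
    intro j hj
    rw [isPseudoGCO_three_five_iff hi hj]
    obtain ⟨hne, hj⟩ := Finset.mem_erase.mp hj
    rcases hsymm i (mem_labels.mpr hi) j (mem_labels.mpr hj) hne with hp | hp
    · exact h _ hp
    · have := h _ hp
      rw [Descends, quint] at this ⊢
      simpa only [hcomm i j] using this

/-! ### Bit masks -/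

/-- The number with the given binary digits, least significant first. -/
def ofBits : List Bool → ℕ
  | [] => 0
  | b :: l => Nat.add b.toNat (Nat.mul 2 (ofBits l))

theorem ofBits_cons (b : Bool) (l : List Bool) : ofBits (b :: l) = 2 ^ 1 * ofBits l + b.toNat :=
  Nat.add_comm ..

theorem testBit_ofBits (l : List Bool) (k : ℕ) : (ofBits l).testBit k = l.getD k false := by
  induction l generalizing k with
  | nil => simp [ofBits]
  | cons b l ih =>
    rw [ofBits_cons, Nat.testBit_two_pow_mul_add _ b.toNat_lt]
    cases k with
    | zero => cases b <;> rfl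
    | succ k => simp [ih]

theorem ofBits_lt (l : List Bool) : ofBits l < 2 ^ l.length := by
  induction l with
  | nil => exact Nat.one_pos
  | cons b l ih =>
    have := b.toNat_lt
    rw [ofBits_cons, List.length_cons, pow_succ]
    omega

/-- The number whose digits in base `2 ^ 13` are given, least significant first. -/
def ofBlocks : List ℕ → ℕ
  | [] => 0
  | b :: l => Nat.add b (Nat.mul 8192 (ofBlocks l))

theorem testBit_ofBlocks {l : List ℕ} (hl : ∀ b ∈ l, b < 2 ^ 13) (j : ℕ) {k : ℕ} (hk : k < 13) :
    (ofBlocks l).testBit (13 * j + k) = (l.getD j 0).testBit k := by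
  induction l generalizing j with
  | nil => simp [ofBlocks]
  | cons b l ih =>
    obtain ⟨hb, hl⟩ := List.forall_mem_cons.mp hl
    rw [show ofBlocks (b :: l) = 2 ^ 13 * ofBlocks l + b from Nat.add_comm ..,
      Nat.testBit_two_pow_mul_add _ hb]
    cases j with
    | zero => simp [hk]
    | succ j =>
      rw [if_neg (by omega), show 13 * (j + 1) + k - 13 = 13 * j + k by omega, ih hl,
        List.getD_cons_succ]

/-- In all blocks of thirteen bits, the lowest twelve bits are set. -/
def ones : ℕ := ofBlocks (pairs.map fun _ => 4095)

/-- In all blocks of thirteen bits, the highest bit is set. -/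
def hi : ℕ := ofBlocks (pairs.map fun _ => 4096)

/-- Provided that the highest bits of all blocks of `a` are not set, checks that
no block of `a` is zero. -/
def ok (a : ℕ) : Bool := Nat.beq (Nat.land (Nat.add a ones) hi) hi

/-- The `j`-th block of `a` has its `k j`-th bit set, but not its highest bit. -/
def Passes (k : ℕ → ℕ) (a : ℕ) : Prop :=
  ∀ j < 21, a.testBit (13 * j + k j) = true ∧ a.testBit (13 * j + 12) = false

theorem Passes.land {k : ℕ → ℕ} {a b : ℕ} (ha : Passes k a) (hb : Passes k b) :
    Passes k (Nat.land a b) := fun j hj => by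
  rw [show Nat.land a b = a &&& b from rfl]
  simp [ha j hj, hb j hj]

set_option exponentiation.threshold 300 in
theorem Passes.ok {k : ℕ → ℕ} (hk : ∀ j < 21, k j < 12) {a : ℕ} (ha : Passes k a) :
    ok a = true := by
  have h_ones : ∀ j < 21, 4095 * 2 ^ (13 * j) ≤ ones % 2 ^ (13 * j + 13) ∧
      ones % 2 ^ (13 * j + 13) < 2 ^ (13 * j + 12) := by decide +kernel
  have h_hi : ∀ n < 13 * 21, hi.testBit n = true → n % 13 = 12 := by decide +kernel
  have h_lt : hi < 2 ^ (13 * 21) := by decide +kernel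
  rw [_root_.ok, Nat.beq_eq]
  refine Nat.eq_of_testBit_eq fun n => ?_
  rw [show Nat.land (Nat.add a ones) hi = (a + ones) &&& hi from rfl, Nat.testBit_land,
    Bool.and_eq_right_iff_imp]
  intro hn
  have hn' : n < 13 * 21 := by
    by_contra! h
    rw [Nat.testBit_lt_two_pow (h_lt.trans_le (Nat.pow_le_pow_right (by decide) h))] at hn
    cases hn
  obtain ⟨j, hj, rfl⟩ : ∃ j < 21, n = 13 * j + 12 :=
    ⟨n / 13, by omega, by have := h_hi n hn' hn; omega⟩
  obtain ⟨h1, h2⟩ := ha j hj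
  obtain ⟨h3, h4⟩ := h_ones j hj
  have hkj := hk j hj
  have h5 : 2 ^ (13 * j) ≤ a % 2 ^ (13 * j + 13) := by
    refine (Nat.pow_le_pow_right (by decide) (Nat.le_add_right _ (k j))).trans
      (Nat.ge_two_pow_of_testBit ?_)
    rw [Nat.testBit_mod_two_pow, h1, Bool.and_true, decide_eq_true_iff]
    omega
  have h6 : a % 2 ^ (13 * j + 13) < 2 ^ (13 * j + 12) := by
    refine Nat.lt_pow_two_of_testBit _ fun i hi => ?_
    rw [Nat.testBit_mod_two_pow]
    rcases hi.eq_or_lt with rfl | hi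
    · simp [h2]
    · simp only [Bool.and_eq_false_imp, decide_eq_true_iff]
      omega
  have h7 : 2 ^ (13 * j + 13) = 2 * 2 ^ (13 * j + 12) := by rw [pow_succ' 2 (13 * j + 12)]
  have h8 : 2 ^ (13 * j + 12) = 4096 * 2 ^ (13 * j) := by
    rw [pow_add, mul_comm]
    rfl
  have h9 : (a + ones) % 2 ^ (13 * j + 13) =
      a % 2 ^ (13 * j + 13) + ones % 2 ^ (13 * j + 13) := by
    rw [Nat.add_mod, Nat.mod_eq_of_lt (by omega)]
  have h10 : ((a + ones) % 2 ^ (13 * j + 13)).testBit (13 * j + 12) = true :=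
    Nat.testBit_of_two_pow_le_and_two_pow_add_one_gt (by omega) (by rw [h9]; omega)
  simpa [Nat.testBit_mod_two_pow] using h10

/-! ### The search -/

/-- All ways to choose one entry from each table such that the intersection of the
masks of all entries and of `acc` stays nonzero in all blocks. -/
def search {α : Type*} : List (List (ℕ × α)) → ℕ → List (List α)
  | [], _ => [[]]
  | T :: Ts, acc => (T.filter fun p => ok (Nat.land acc p.1)).flatMap fun p =>
    (search Ts (Nat.land acc p.1)).map (p.2 :: ·)

section Search

variable {α : Type*}

theorem mem_search_of_passes {k : ℕ → ℕ} (hk : ∀ j < 21, k j < 12) {Ts : List (List (ℕ × α))}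
    {ps : List (ℕ × α)} (h : List.Forall₂ (fun T p => p ∈ T ∧ Passes k p.1) Ts ps) {acc : ℕ}
    (ha : Passes k acc) : ps.map Prod.snd ∈ search Ts acc := by
  induction h generalizing acc with
  | nil => simp [search]
  | cons hp _ ih =>
    obtain ⟨hp, hm⟩ := hp
    exact List.mem_flatMap.mpr ⟨_, List.mem_filter.mpr ⟨hp, (ha.land hm).ok hk⟩,
      List.mem_map_of_mem (ih (ha.land hm))⟩

theorem forall₂_of_mem_search {Ts : List (List (ℕ × α))} {acc : ℕ} {w : List α}
    (h : w ∈ search Ts acc) : List.Forall₂ (fun T r => r ∈ T.map Prod.snd) Ts w := by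
  induction Ts generalizing acc w with
  | nil =>
    rw [List.mem_singleton.mp h]
    exact .nil
  | cons T Ts ih =>
    obtain ⟨p, hp, h⟩ := List.mem_flatMap.mp h
    obtain ⟨v, hv, rfl⟩ := List.mem_map.mp h
    exact .cons (List.mem_map_of_mem (List.mem_of_mem_filter hp)) (ih hv)

theorem nodup_search {Ts : List (List (ℕ × α))} (hT : ∀ T ∈ Ts, (T.map Prod.snd).Nodup)
    (acc : ℕ) : (search Ts acc).Nodup := by
  induction Ts generalizing acc with
  | nil => exact List.nodup_singleton _
  | cons T Ts ih =>
    obtain ⟨hT, hTs⟩ := List.forall_mem_cons.mp hT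
    refine List.nodup_flatMap.mpr ⟨fun p _ => (ih hTs _).map List.cons_injective, ?_⟩
    · refine ((List.pairwise_map.mp hT).filter _).imp fun {p q} hne => ?_
      rw [Function.onFun, List.disjoint_left]
      intro w hp hq
      obtain ⟨v, -, rfl⟩ := List.mem_map.mp hp
      obtain ⟨v', -, h⟩ := List.mem_map.mp hq
      exact hne (List.cons.inj h).1.symm

end Search

/-! ### The tables -/

/-- The letter opposite to `m` in a cyclic word of length four. -/
def opp (m : ℕ) : List ℕ → ℕ
  | [a, b, c, d] =>
    bif Nat.beq a m then c else bif Nat.beq b m then d else bif Nat.beq c m then a else b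
  | _ => 0

theorem DihEquiv.opp_eq {m : ℕ} {l l' : List ℕ} (h : DihEquiv l l') (hn : l.Nodup)
    (hl : l.length = 4) (hm : m ∈ l) : opp m l = opp m l' := by
  obtain ⟨a, b, c, d, rfl⟩ : ∃ a b c d, l = [a, b, c, d] := by
    match l, hl with
    | [a, b, c, d], _ => exact ⟨a, b, c, d, rfl⟩
  have hb (x y : ℕ) : Nat.beq x y = decide (x = y) := by
    rw [Bool.eq_iff_iff]; simp [Nat.beq_eq]
  simp only [List.nodup_cons, List.mem_cons, List.not_mem_nil, not_or] at hn hm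
  have h : l' ∈ [[a, b, c, d], [b, c, d, a], [c, d, a, b], [d, a, b, c],
      [d, c, b, a], [c, b, a, d], [b, a, d, c], [a, d, c, b]] := mem_dihedralWords.mpr h
  simp only [List.mem_cons, List.not_mem_nil, or_false] at h
  rcases h with rfl | rfl | rfl | rfl | rfl | rfl | rfl | rfl <;>
    simp only [opp, hb] <;> grind

/-- A letter whose opposite tells apart the color orderings on `quint p` with `i` deleted. -/
def pivot (i : ℕ) (p : ℕ × ℕ) : ℕ := (del i (quint p)).headD 0

/-- Marks the color orderings on `quint p` which are compatible with `r` in the component at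
`i`. -/
def block (i : ℕ) (r : List ℕ) (p : ℕ × ℕ) : ℕ :=
  bif Nat.beq p.1 i || Nat.beq p.2 i then 4095 else
    ofBits (((colorOrderings (quint p)).map fun b => opp (pivot i p) (del i b)).map
      (Nat.beq (opp (pivot i p) (del p.2 (del p.1 r)))))

/-- The blocks for all pairs of labels. -/
def mask (i : ℕ) (r : List ℕ) : ℕ := ofBlocks (pairs.map (block i r))

/-- The component `r` at `i` is compatible with the color ordering `[1, 2, 3, 4, 5]`. -/
def agree (i : ℕ) (r : List ℕ) : Bool :=
  Nat.blt 5 i || decide (DihEquiv (del 7 (del 6 r)) (del i [1, 2, 3, 4, 5]))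

/-- The candidates for the component at `i`, with their masks. -/
def table (i : ℕ) : List (ℕ × List ℕ) :=
  ((colorOrderings (del i labels)).filter (agree i)).map fun r => (mask i r, r)

/-- The systems of components compatible with `[1, 2, 3, 4, 5]` found by the search. -/
def solutions : List (List (List ℕ)) := search (labels.map table) ones

theorem length_colorOrderings_quint : ∀ p ∈ pairs, (colorOrderings (quint p)).length = 12 := by
  decide +kernel

theorem length_del_quint : ∀ p ∈ pairs, ∀ i ∈ quint p, (del i (quint p)).length = 4 := by
  decide +kernel

theorem block_lt (i : ℕ) (r : List ℕ) {p : ℕ × ℕ} (hp : p ∈ pairs) : block i r p < 2 ^ 12 := by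
  unfold block
  cases Nat.beq p.1 i || Nat.beq p.2 i
  · refine (ofBits_lt _).trans_eq ?_
    rw [List.length_map, List.length_map, length_colorOrderings_quint p hp]
  · rw [cond_true]
    decide

theorem testBit_block {i : ℕ} (hi : i ∈ labels) {r : List ℕ}
    (hr : r.Perm (del i labels)) {p : ℕ × ℕ} (hp : p ∈ pairs) {k : ℕ} (hk : k < 12)
    (h : i ∈ quint p →
      DihEquiv (del p.2 (del p.1 r)) (del i ((colorOrderings (quint p)).getD k []))) :
    (block i r p).testBit k = true := by
  unfold block
  cases hb : Nat.beq p.1 i || Nat.beq p.2 i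
  · have hiq : i ∈ quint p := by
      refine mem_quint.mpr ⟨⟨hi, ?_⟩, ?_⟩ <;> rintro rfl <;> simp at hb
    have hl := length_colorOrderings_quint p hp
    have hperm : (del p.2 (del p.1 r)).Perm (del i (quint p)) := by
      refine ((hr.filter _).filter _).trans (.of_eq ?_)
      simp only [quint, del, List.filter_filter]
      exact List.filter_congr fun x _ => by ac_rfl
    have hlen := length_del_quint p hp i hiq
    have hpivot : pivot i p ∈ del i (quint p) := by
      unfold pivot
      cases hd : del i (quint p) with
      | nil => simp [hd] at hlen
      | cons x l => simp
    have h := (h hiq).opp_eq (m := pivot i p)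
      (hperm.nodup_iff.mpr (.filter _ (nodup_quint p)))
      (hperm.length_eq.trans hlen) (hperm.mem_iff.mpr hpivot)
    rw [List.getD_eq_getElem _ _ (by omega)] at h
    rw [cond_false, testBit_ofBits, List.getD_eq_getElem _ _ (by simp; omega)]
    simp [h]
  · clear h
    rw [cond_true]
    revert k
    decide

theorem passes_mask {i : ℕ} (hi : i ∈ labels) {r : List ℕ} (hr : r.Perm (del i labels))
    {k : ℕ → ℕ} (hk : ∀ j < 21, k j < 12)
    (h : ∀ j < 21, i ∈ quint (pairs.getD j (0, 0)) →
      DihEquiv (del (pairs.getD j (0, 0)).2 (del (pairs.getD j (0, 0)).1 r))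
        (del i ((colorOrderings (quint (pairs.getD j (0, 0)))).getD (k j) []))) :
    Passes k (mask i r) := by
  intro j hj
  have hlt : ∀ b ∈ pairs.map (block i r), b < 2 ^ 13 := by
    intro b hb
    obtain ⟨p, hp, rfl⟩ := List.mem_map.mp hb
    exact (block_lt i r hp).trans (by decide)
  have hlen : j < pairs.length := hj
  have hp : pairs.getD j (0, 0) ∈ pairs := by
    rw [List.getD_eq_getElem _ _ hlen]
    exact List.getElem_mem hlen
  have hget : (pairs.map (block i r)).getD j 0 = block i r (pairs.getD j (0, 0)) := by
    rw [List.getD_eq_getElem _ _ (by simpa using hlen), List.getD_eq_getElem _ _ hlen,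
      List.getElem_map]
  have hkj := hk j hj
  rw [mask, testBit_ofBlocks hlt j (by omega), testBit_ofBlocks hlt j (by decide), hget]
  exact ⟨testBit_block hi hr hp hkj (h j hj), Nat.testBit_lt_two_pow (block_lt i r hp)⟩

theorem passes_ones {k : ℕ → ℕ} (hk : ∀ j < 21, k j < 12) : Passes k ones := by
  have h : ∀ j < 21, ones.testBit (13 * j + 12) = false ∧
      ∀ k < 12, ones.testBit (13 * j + k) = true := by decide +kernel
  exact fun j hj => ⟨(h j hj).2 _ (hk j hj), (h j hj).1⟩

theorem mem_solutions {x : ℕ → List ℕ} (hx : ∀ i ∈ labels, x i ∈ colorOrderings (del i labels))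
    (ha : ∀ i ∈ labels, agree i (x i) = true) (hd : ∀ p ∈ pairs, Descends x p) :
    labels.map x ∈ solutions := by
  have h (j : ℕ) : ∃ k, j < 21 → k < 12 ∧ ∀ i ∈ quint (pairs.getD j (0, 0)),
      DihEquiv (del (pairs.getD j (0, 0)).2 (del (pairs.getD j (0, 0)).1 (x i)))
        (del i ((colorOrderings (quint (pairs.getD j (0, 0)))).getD k [])) := by
    by_cases hj : j < 21
    · have hp : pairs.getD j (0, 0) ∈ pairs := by
        rw [List.getD_eq_getElem _ _ hj]
        exact List.getElem_mem hj
      obtain ⟨b, hb, h⟩ := hd _ hp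
      obtain ⟨k, hk, rfl⟩ := List.mem_iff_getElem.mp hb
      refine ⟨k, fun _ => ⟨by rwa [length_colorOrderings_quint _ hp] at hk, fun i hi => ?_⟩⟩
      rw [List.getD_eq_getElem _ _ hk]
      exact h i hi
    · exact ⟨0, fun h => absurd h hj⟩
  choose k hk using h
  have hk' : ∀ j < 21, k j < 12 := fun j hj => (hk j hj).1
  have := mem_search_of_passes hk' (Ts := labels.map table)
    (ps := labels.map fun i => (mask i (x i), x i)) ?_ (passes_ones hk')
  · rw [List.map_map] at this
    exact this
  · rw [List.forall₂_map_left_iff, List.forall₂_map_right_iff, List.forall₂_same]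
    intro i hi
    have hm : Passes k (mask i (x i)) :=
      passes_mask hi (perm_of_mem_colorOrderings (hx i hi)) hk' fun j hj => (hk j hj).2 i
    dsimp only
    refine ⟨?_, hm⟩
    rw [table]
    exact List.mem_map_of_mem (f := fun r => (mask i r, r))
      (List.mem_filter.mpr ⟨hx i hi, ha i hi⟩)

/-- The component at `i` of a system of seven components. -/
def comp (w : List (List ℕ)) (i : ℕ) : List ℕ := w.getD (Nat.pred i) []

theorem map_comp_of_length {w : List (List ℕ)} (h : w.length = 7) : labels.map (comp w) = w := by
  match w, h with
  | [_, _, _, _, _, _, _], _ => rfl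

theorem comp_map {x : ℕ → List ℕ} : ∀ i ∈ labels, comp (labels.map x) i = x i := by
  simp [labels, comp]

theorem comp_of_mem_solutions {w : List (List ℕ)} (h : w ∈ solutions) :
    w.length = 7 ∧
      ∀ i ∈ labels, comp w i ∈ colorOrderings (del i labels) ∧ agree i (comp w i) = true := by
  have h := forall₂_of_mem_search h
  have hl : w.length = 7 := h.length_eq.symm
  refine ⟨hl, ?_⟩
  rw [← map_comp_of_length hl, List.forall₂_map_left_iff, List.forall₂_map_right_iff,
    List.forall₂_same] at h
  intro i hi
  have := h i hi
  simpa [table] using this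

theorem nodup_solutions : solutions.Nodup := by
  refine nodup_search (fun T hT => ?_) _
  obtain ⟨i, -, rfl⟩ := List.mem_map.mp hT
  simp only [table, List.map_map, Function.comp_def, List.map_id']
  exact (nodup_colorOrderings (.filter _ (by decide))).filter _

/-! ### Realization of systems of components -/

theorem isGCO_iff {σ : Finset ℕ → List ℕ} : IsGCO σ ↔
    (∀ i ∈ labels, (σ {i}).Perm (del i labels)) ∧ ∀ p ∈ pairs, Descends (fun a => σ {a}) p := by
  refine and_congr ?_ isPseudoGCO_three_seven_iff
  rw [IsPreGCO, forall_subset_card_one]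
  simp only [← mem_labels]
  refine forall₂_congr fun i _ => ?_
  have hn : (del i labels).Nodup := .filter _ (by decide)
  have hd : (del i labels).toFinset = Finset.Icc 1 7 \ {i} := by
    ext x
    simp [mem_del, mem_labels]
  rw [← hd]
  exact ⟨fun h => (List.perm_ext_iff_of_nodup h.1 hn).mpr fun x => by
      rw [← List.mem_toFinset, h.2, List.mem_toFinset],
    fun h => ⟨h.nodup_iff.mpr hn, List.toFinset_eq_of_perm _ _ h⟩⟩

/-- The pre-GCO with given components. -/
def realize (w : List (List ℕ)) (I : Finset ℕ) : List ℕ := comp w (I.sup id)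

theorem realize_singleton (w : List (List ℕ)) (i : ℕ) : realize w {i} = comp w i := by
  simp [realize]

/-- Representatives of the relabeling orbits of `(3,7)` pseudo-GCOs. -/
def reps : List (List (List ℕ)) :=
  [[[2, 3, 4, 5, 6, 7], [1, 3, 4, 5, 6, 7], [1, 2, 4, 5, 6, 7], [1, 2, 3, 5, 6, 7],
      [1, 2, 3, 4, 6, 7], [1, 2, 3, 4, 5, 7], [1, 2, 3, 4, 5, 6]],
    [[2, 3, 4, 5, 6, 7], [1, 3, 4, 5, 6, 7], [1, 2, 4, 5, 6, 7], [1, 2, 3, 5, 6, 7],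
      [1, 2, 3, 4, 7, 6], [1, 2, 3, 4, 7, 5], [1, 2, 3, 4, 6, 5]],
    [[2, 3, 4, 5, 6, 7], [1, 3, 4, 5, 6, 7], [1, 2, 4, 5, 6, 7], [1, 2, 3, 5, 7, 6],
      [1, 2, 3, 4, 7, 6], [1, 2, 3, 7, 4, 5], [1, 2, 3, 6, 4, 5]],
    [[2, 3, 4, 5, 6, 7], [1, 3, 4, 5, 6, 7], [1, 2, 4, 5, 6, 7], [1, 2, 3, 7, 5, 6],
      [1, 2, 3, 7, 4, 6], [1, 2, 3, 7, 4, 5], [1, 2, 3, 6, 5, 4]],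
    [[2, 3, 4, 5, 6, 7], [1, 3, 4, 5, 6, 7], [1, 2, 4, 5, 7, 6], [1, 2, 3, 7, 5, 6],
      [1, 2, 3, 7, 4, 6], [1, 2, 7, 3, 4, 5], [1, 2, 6, 3, 5, 4]],
    [[2, 3, 4, 5, 6, 7], [1, 3, 4, 5, 6, 7], [1, 2, 4, 5, 7, 6], [1, 2, 3, 7, 6, 5],
      [1, 2, 3, 7, 6, 4], [1, 2, 7, 3, 5, 4], [1, 2, 6, 3, 5, 4]],
    [[2, 3, 4, 5, 6, 7], [1, 3, 4, 5, 6, 7], [1, 2, 4, 6, 5, 7], [1, 2, 3, 6, 7, 5],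
      [1, 2, 6, 3, 7, 4], [1, 2, 5, 3, 4, 7], [1, 2, 3, 5, 4, 6]],
    [[2, 3, 4, 5, 6, 7], [1, 3, 4, 5, 6, 7], [1, 2, 4, 6, 5, 7], [1, 2, 3, 7, 6, 5],
      [1, 2, 6, 3, 7, 4], [1, 2, 5, 3, 7, 4], [1, 2, 3, 5, 6, 4]],
    [[2, 3, 4, 5, 6, 7], [1, 3, 4, 5, 6, 7], [1, 2, 4, 6, 7, 5], [1, 2, 3, 6, 7, 5],
      [1, 2, 6, 7, 3, 4], [1, 2, 5, 3, 4, 7], [1, 2, 5, 3, 4, 6]],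
    [[2, 3, 4, 5, 6, 7], [1, 3, 4, 5, 6, 7], [1, 2, 7, 4, 6, 5], [1, 2, 7, 3, 6, 5],
      [1, 2, 6, 7, 3, 4], [1, 2, 5, 7, 3, 4], [1, 2, 5, 6, 4, 3]],
    [[2, 3, 4, 5, 6, 7], [1, 3, 4, 5, 7, 6], [1, 2, 4, 7, 5, 6], [1, 2, 3, 7, 6, 5],
      [1, 2, 7, 3, 6, 4], [1, 4, 5, 3, 2, 7], [1, 4, 3, 5, 2, 6]]]

set_option maxRecDepth 100000 in
theorem isGCO_reps {w : List (List ℕ)} (hw : w ∈ reps) : IsGCO (realize w) := by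
  have h : ∀ w ∈ reps, (∀ i ∈ labels, (comp w i).Perm (del i labels)) ∧
      ∀ p ∈ pairs, ∃ b ∈ colorOrderings (quint p), ∀ a ∈ quint p,
        DihEquiv (del p.2 (del p.1 (comp w a))) (del a b) := by decide +kernel
  rw [isGCO_iff]
  simp only [realize_singleton]
  exact h w hw

/-! ### Relabelings of solutions to representatives -/

/-- The digits of a hexadecimal number. -/
def digit (d x : ℕ) : ℕ := Nat.land (Nat.shiftRight d (Nat.mul 4 x)) 15

/-- Checks that the permutation of labels given by the nonzero digits of `d` maps the system
of components `w` to the representative given by the zeroth digit of `d`. -/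
def certifies (w : List (List ℕ)) (d : ℕ) : Bool :=
  Nat.blt (digit d 0) 11 && (labels.all fun y => labels.any fun x => Nat.beq (digit d x) y) &&
    labels.all fun i =>
      (canon ((del (digit d i) labels).headD 0) ((comp w i).map (digit d))).isEqv
        (comp (reps.getD (digit d 0) []) (digit d i)) Nat.beq

theorem isEqv_natBeq_iff {l l' : List ℕ} : l.isEqv l' Nat.beq = true ↔ l = l' := by
  induction l generalizing l' with
  | nil => cases l' <;> simp [List.isEqv]
  | cons x l ih => cases l' <;> simp [List.isEqv, Nat.beq_eq, ih]

theorem exists_relabelRel_of_certifies {w : List (List ℕ)} {d : ℕ} (h : certifies w d = true)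
    (hw : ∀ i ∈ labels, (comp w i).Perm (del i labels)) :
    ∃ v ∈ reps, RelabelRel 3 (Finset.Icc 1 7) (realize w) (realize v) := by
  simp only [certifies, Bool.and_eq_true, List.all_eq_true, List.any_eq_true, Nat.blt_eq,
    Nat.beq_eq, isEqv_natBeq_iff] at h
  obtain ⟨⟨hk, hs⟩, h⟩ := h
  have hmem : reps.getD (digit d 0) [] ∈ reps := by
    rw [List.getD_eq_getElem _ _ hk]
    exact List.getElem_mem hk
  refine ⟨_, hmem, ?_⟩
  simp only [mem_labels] at hs
  obtain ⟨ρ, hρ, hρd⟩ := exists_perm_of_surjOn hs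
  refine ⟨ρ, hρ, forall_subset_card_one.mpr fun j hj => ?_⟩
  obtain ⟨i, rfl⟩ := ρ.surjective j
  have hi := (hρ i).mpr hj
  change DihEquiv (relabel ρ (realize w) {ρ i}) _
  rw [relabel_singleton, realize_singleton, realize_singleton]
  have hi' := mem_labels.mpr hi
  have hmap : (comp w i).map ρ = (comp w i).map (digit d) :=
    List.map_congr_left fun x hx =>
      hρd x (mem_labels.mp (mem_del.mp ((hw i hi').mem_iff.mp hx)).1)
  have hh : ∀ x ∈ labels, (del x labels).headD 0 ∈ del x labels := by decide
  have hh := mem_del.mp (hh _ (mem_labels.mpr hj))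
  rw [mem_labels, ← ρ.apply_symm_apply ((del (ρ i) labels).headD 0), ← hρ] at hh
  have hm : (del (ρ i) labels).headD 0 ∈ (comp w i).map ρ := by
    rw [List.mem_map]
    refine ⟨_, (hw i hi').mem_iff.mpr (mem_del.mpr ⟨mem_labels.mpr hh.1, ?_⟩),
      ρ.apply_symm_apply _⟩
    exact fun h => hh.2 (congrArg ρ h)
  have hc := dihEquiv_canon hm
  have := h i hi'
  rw [← hmap, ← hρd i hi] at this
  rwa [this] at hc

set_option maxRecDepth 100000 in
/-- Permutations taking the solutions to representatives, encoded for `certifies`. -/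
def relabelings : List ℕ :=
  [1985229328, 1985229329, 1164382769, 1164382770, 1985229330, 1985229331, 1164382771, 1126258289,
  392512290, 1985229334, 1985229335, 1194464851, 878080295, 1985229336, 558314855, 927016535,
  1158821490, 1980904530, 1985229332, 1985229333, 878080533, 878080532, 1949439569, 878080531,
  840255330, 840332370, 1985229337, 878080530, 878080297, 1731335493, 878080529, 1732452689,
  1732452690, 1730364690, 1730364689, 591750933, 1730364692, 1730364691, 660947732, 1126655253,
  1197548370, 1197548369, 1465983810, 1683169654, 1180111415, 1194464852, 1196823098, 1129453414,
  1412523818, 1935807574, 1982993734, 877733732, 1629771573, 1165366058, 1131550052, 1666454133,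
  1666454132, 910239578, 1679914294, 1679914295, 1464017249, 908150133, 1966216770, 1952523092,
  660947731, 660947730, 660947729, 1916032528, 1415782770, 1447502137, 1935807575, 1730364696,
  1985028933, 1730364697, 307459175, 594825570, 1125606695, 1730364694, 1730364695, 1411479090,
  1411479091, 1447240049, 846615573, 1447236217, 1916032532, 1985229338, 1949439570, 1394689655,
  558257015, 594956615, 1410479731, 1730364688, 1411479089, 1899255330, 1952523091, 1916032531,
  1179853175, 1916032530, 1361278535, 1985028935, 645087576, 1731335495, 911479411, 1916032529,
  359084615, 1678914935, 1164124531, 1126655249, 840263495, 1126655250, 305489015, 591880530,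
  895750775, 1126655251, 1164387098, 1126655252, 879042937, 1730364693, 879039089, 593839891,
  1695691895, 1697781575, 591749491, 880169249, 880169250, 846599490, 880169251, 880169252,
  1947350369, 880169253, 1983140133, 1129391969, 1983140132, 1983140131, 1982993730, 1983140130,
  1983140129, 1729246293, 1983140137, 843388530, 557270615, 880169497, 1160910690, 924927335,
  880169496, 1983140135, 880169495, 880169494, 1192375651, 390423090, 1159160611, 1159160610,
  1159160609, 880169488, 1649677173, 1649677172, 1696691254, 1696810774, 1445033010, 1398882938,
  1159160615, 1177687892, 1685197658, 1966216774, 1696810776, 1952584534, 1952584535, 593839892,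
  1130833178, 339042935, 658858773, 624189817, 1678914929, 611733811, 611733810, 611733809,
  1177687891, 827749415, 1175598450, 910239575, 1160209173, 1160209172, 558326610, 1696810772,
  1696810773, 1696810771, 593969489, 844526609, 1160910691, 844526615, 307644215, 893462375,
  1731481898, 1192375650, 659829092, 877795177, 592867653, 1696810769, 1696810770, 1160209177,
  844526617, 1115034933, 1631790930, 1366500450, 1115034932, 1681004373, 1697781573, 625176937,
  1165103972, 561271650, 1131812138, 341013095, 1696691255, 1696810775, 592736611, 342177575,
  1698898298, 591749492, 1125283412, 1632904053, 874600052, 1415656058, 1159098938, 874608214,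
  924927334, 1730237494, 1192375652, 1461806130, 1175933735, 1192645418, 1680037654, 896942370,
  829826370, 896942371, 896942372, 1966367013, 1125283411, 1380128609, 896942373, 1966367012,
  896942375, 874608215, 1093817970, 1899128130, 1112618849, 1966367011, 896942377, 1966367010,
  1662154053, 1966367009, 1966367017, 826615410, 607589975, 1966367015, 896942616, 896942614,
  373649970, 1175933731, 1175933730, 1175933729, 896942609, 896942608, 610613014, 660935734,
  373650215, 1683165818, 607458932, 1175933733, 390423338, 657724774, 607589974, 356999738,
  627512134, 627323254, 1175933732, 643240770, 642085655, 645218615, 642085654, 645218614,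
  1648564049, 642085651, 628506931, 628506930, 642085653, 642085652, 640962937, 1114060053,
  610613015, 660935735, 1964127335, 1114060056, 376644695, 643051890, 1901216615, 1176982296,
  343225898, 594825574, 1648564050, 1630684535, 1383273570, 1098261812, 1662154055, 1680037650,
  1176982297, 1445033013, 1444033653, 1980904535, 1648588056, 1730237495, 659829090, 659829091,
  359867495, 1680037655, 325395575, 1680037651, 610742610, 610742609, 1680037652, 1176982298,
  1680037653, 1114060052, 1097282852, 627519810, 392381015, 376652378, 591880534, 627315570,
  643044214, 643248454, 610603891, 1680037649, 625350457, 659960133, 341190455, 1697935658,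
  592736612, 627324697, 660947253, 1685136215, 1177687894, 1952523098, 1662277413, 910239572,
  356938535, 1666454138, 624170612, 1382105973, 1192645412, 659952450, 356938530, 1949655574,
  1949655576, 1108571731, 1396840289, 913654053, 1949655332, 913654055, 824473175, 1110529650,
  1915839810, 913654051, 913654052, 1949655333, 1949655331, 913654057, 1949655330, 1095907169,
  1192645411, 1949655575, 657724775, 893462370, 1949655577, 913384530, 913654290, 1645442373,
  1949655329, 913654289, 913654288, 1192645410, 1192645409, 645218611, 1665275729, 625373971,
  625373970, 625373975, 628506935, 1416700775, 1930712618, 1165103977, 1412507497, 929382698,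
  1377068855, 1160910695, 1379361815, 893462371, 643051889, 1399985250, 1665275730, 1647396215,
  389435975, 1917928295, 1193693976, 325534295, 1383286297, 1177687895, 1362584615, 659829089,
  910239571, 1662277415, 610742611, 1193693975, 1193693974, 1362584610, 1379361810, 1379361811,
  1193693977, 1663325970, 1645442375, 1898275655, 591880536, 642062137, 643248453, 627315571,
  1663325969, 643044215, 643248455, 610603890, 1450255170, 1698898294, 1164382775, 1160910694,
  1396795178, 893462372, 1645500213, 1732452691, 1732452692, 593838453, 924210210, 928387650,
  625373489, 1931761168, 645219089, 645219090, 376783650, 1969500694, 1969500695, 1180111409,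
  1969500688, 1969500689, 1969500690, 1180111410, 1180111411, 1110529649, 1969500691, 893808929,
  1668420693, 893809177, 1902261330, 1969500693, 1969500692, 1095907170, 879830375, 1969500696,
  605500775, 824526690, 824603730, 1969500697, 893809170, 893809172, 893809173, 893809171,
  1933710929, 893809175, 1131550051, 655774770, 1196823092, 1196823093, 1380017972, 1662277418,
  360071735, 1464017251, 1464017250, 1110926617, 611733817, 1952523093, 1181819730, 1181819729,
  1415782769, 1415778937, 925258773, 1095907171, 925258775, 605442935, 657871175, 1969500698,
  1931761172, 1378961015, 1933710930, 844187495, 1131550050, 337995570, 925258774, 925258776,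
  1930712615, 593969495, 1447240050, 1416044857, 1969300293, 1651721497, 1165042529, 1094149411,
  1094149410, 1094149409, 1179853171, 1110926609, 824534855, 1110926610, 911479415, 1110926611,
  1969300295, 660816216, 1164124535, 1931761171, 1377007175, 1931761170, 925258777, 374813255,
  1931761169, 895750771, 1631729493, 1984238137, 879039090, 624191256, 1947362615, 891385414,
  908150134, 1678931258, 1175598452, 1193370929, 1130832213, 1193370930, 658858292, 1948472848,
  628507409, 642085169, 642085170, 907498530, 911675970, 628507414, 625373494, 624191254,
  359088938, 639063090, 1180111412, 1180111413, 605370212, 622289974, 605500774, 655636054,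
  655713094, 392512058, 607478134, 1678989098, 376783415, 910520610, 1952788777, 910520609,
  1651709013, 910520857, 1196823089, 1952789008, 1952789009, 1952789010, 1196823090, 1196823091,
  1093817969, 1952789011, 1112618850, 1918973010, 1952789013, 1952789012, 910520852, 910520853,
  908162370, 891373170, 655636055, 910520856, 1952788775, 910520854, 360071730, 829695335,
  910520855, 1114838371, 910520851, 1916999249, 1399267653, 624191249, 874600051, 1399267655,
  1464017252, 388187490, 337868370, 1125275255, 1382495253, 1113920377, 1365517175, 1380152852,
  910520858, 628507416, 1967333734, 374616690, 354707250, 605442934, 657871174, 908547094,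
  908547096, 1112618851, 1399071089, 1399067257, 908547093, 1952789018, 1948472852, 371480375,
  1685401898, 611537252, 908547095, 827475815, 1114838370, 1362249335, 1916999250, 1948472851,
  1130701175, 1176597813, 908547097, 1948472850, 1393718855, 371410290, 354645570, 605451092,
  1175598453, 1193370931, 391393890, 1097147249, 342307410, 1382495252, 1948472853, 908547091,
  1380152853, 908547092, 1179853172, 1179853173, 1683431738, 607609172, 1951801655, 1951801654,
  359084610, 323383898, 660816214, 1947424295, 660816215, 355759658, 609448294, 1967526457,
  895750770, 1176597812, 1648441173, 1948472849, 879039091, 1177687890, 908150135, 1175598451,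
  829837895, 1965245968, 658858289, 658858290, 658858291, 1176597809, 1176597810, 372528930,
  1965245974, 1965245976, 640964370, 371422535, 1966216775, 607478135, 1110925656, 655713095,
  640964369, 1649677171, 1158821495, 927293978, 1411462777, 1382494535, 1382290295, 927293731,
  927293730, 1936015657, 927293729, 1634935893, 1936015888, 1936015889, 927293977, 1129391970,
  1936015890, 1935746130, 1936015891, 1936015892, 927293973, 927293732, 924935490, 874600050,
  588543575, 1936015653, 1160910689, 1096184611, 1936015655, 927293976, 1096184610, 927293974,
  1096184609, 343298610, 846468455, 927293975, 1098065251, 1410479729, 1446123330, 1159820854,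
  1697781574, 1444033650, 826761810, 891773970, 891773972, 1965245973, 891773971, 1113920369,
  1177687889, 1112961811, 1112961809, 1112961810, 1965245969, 1665214293, 1193370932, 1460810850,
  1965245971, 1383470133, 1112961817, 891773977, 1965245970, 1129391971, 1382297969, 891773973,
  1965245972, 354707255, 893462377, 1668628778, 624386373, 628310372, 891773975, 877795175,
  1098065250, 1900226130, 1651851572, 607609173, 1651851573, 1649686297, 1159820855, 1400247338,
  1410496057, 829706850, 1965245977, 1965245975, 609448295, 1176597811, 609645329, 609645330,
  609645331, 1681004369, 1964127330, 1948345652, 1461929489, 910239573, 609645337, 628495413,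
  1395090457, 1461929490, 1461929491, 1396778857, 913654058, 1361340215, 1379361093, 1383285092,
  1129453415, 1395090455, 343090530, 390276690, 877733731, 627323249, 1461929492, 1395090453,
  1110925653, 645218612, 643053337, 645218613, 1158837817, 896930858, 1411479095, 1695691890,
  1446123334, 1411479094, 1697781570, 1412568929, 929382693, 1092843091, 929382695, 1933926692,
  1931568450, 840201815, 1126258290, 341209890, 1933926934, 1933926936, 1098273329, 1098273330,
  1933926935, 594810215, 1098273331, 1158821489, 1933926691, 1933926690, 929382697, 1933926689,
  1629713733, 929382928, 929382929, 877733730, 1933926937, 929113170, 929382930, 1933926933,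
  929382932, 929382931, 326390370, 1461929497, 1112764775, 1461929495, 1679914291, 1678914931,
  326521415, 1663124855, 1681004370, 1917149491, 1917149490, 1461929488, 1917149489, 1679914290,
  1679914289, 1461929496, 1461929494, 1630820130, 1110794615, 1462900295, 1914004295, 607609176,
  1629713735, 1647597330, 1159804537, 1933926938, 1410479735, 627315575, 627519815, 1647597329,
  643044211, 323445330, 1395090450, 1461929493, 1395090452, 1395090451, 610603889, 594826771,
  1698898295, 1701913415, 873817889, 1732452693, 874866457, 873817890, 1934889577, 873817891,
  1951605089, 1647396213, 1181819732, 594826772, 1702113818, 657871893, 1683169649, 1683165817,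
  605382451, 338056055, 605382450, 605382449, 1181819731, 1161196053, 1161196052, 1702113812,
  1634874450, 1702113813, 1363294050, 1702113811, 1702113810, 1702113808, 1702113809, 1447498291,
  843142769, 1447498290, 1447498289, 1161196057, 1161195809, 1935807573, 1161195810, 1702113577,
  557139810, 557216850, 338113895, 1702113816, 1949378135, 1702113815, 1702113814, 1981104930,
  1161195815, 1933710931, 1161195811, 1131550049, 1112631092, 1464209973, 388387890, 1464209972,
  874866454, 1729446698, 1981104935, 874866456, 309617975, 560231255, 1447240051, 843539729,
  1165042530, 1165042531, 928256615, 843539735, 1685136213, 874866455, 896668775, 843539737,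
  1196630371, 1196630370, 1701913413, 1683431737, 1179853170, 913445975, 826762535, 1160849252,
  1129408298, 893523814, 913445974, 1699156535, 1164124534, 1985028930, 1967526458, 1933710932,
  1981104933, 1680942938, 895750773, 895750772, 873817892, 844195650, 845239410, 343103015,
  1125544538, 1130832211, 1130832212, 890529575, 1732452698, 1934893409, 1630684533, 1648441171,
  372724775, 890529570, 1951601257, 611538454, 389436458, 641160214, 622094130, 638867254,
  641160215, 1380005731, 641160213, 1666457969, 1666454137, 638867255, 641160212, 641160211,
  1112765973, 611538455, 1967333735, 342054698, 1095919412, 1447498292, 1447498293, 371676210,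
  588674134, 588597094, 638809414, 622020214, 325341818, 1696023338, 891578134, 1964393255,
  1899242855, 1380005730, 1685402132, 1651586130, 1685402133, 1919095893, 1177907737, 1177907489,
  1685402131, 1685402129, 1685402130, 1685402128, 605255249, 1464209970, 1464209971, 1464209969,
  1685402134, 1685402135, 1964393250, 388249175, 1177907736, 623986290, 640775490, 1177907492,
  1177907493, 1685401897, 1177907490, 1177907491, 1114838369, 1177907495, 1916999251, 1901470530,
  1130701174, 1732579895, 610358132, 610358133, 1916999252, 1984238138, 1447240052, 1447240053,
  879170135, 1984110934, 1984110935, 1097147250, 1935024454, 1649882136, 1177907738, 1632904055,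
  1112765972, 1194680618, 356661095, 609302377, 323114615, 607213171, 1666654535, 891578129,
  605255250, 1196630372, 655574370, 1666654533, 1095988772, 622032450, 638797170, 373438295,
  658593335, 1112765976, 341996858, 640763254, 623998534, 610366294, 343041335, 891578136,
  610366295, 658593334, 659637094, 827483970, 828527730, 1679897978, 1648441172, 879039093,
  879039092, 559183410, 1158837812, 593970450, 1130832210, 1130832209, 308623175, 845485175,
  1159948051, 658728217, 1934893410, 1934893411, 1383273575, 1159948055, 658728216, 1965122615,
  658728215, 1951601255, 658728214, 326518058, 593970454, 390292775, 373519658, 593970456,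
  1651709015, 1666457970, 1196826937, 1902453815, 1399267650, 325535010, 827618850, 1967333737,
  560231734, 1094068058, 1415778933, 1415778932, 557205334, 557151334, 373446458, 1158899492,
  846599494, 1651709014, 1380128614, 827615018, 843519572, 1447498298, 1633100610, 1399071094,
  1464209975, 1095983738, 843388534, 1094002292, 1696023333, 306525810, 1094133335, 1193358695,
  1417032216, 843519571, 1446277415, 1417032215, 1696023330, 1417032214, 1417032210, 1417032211,
  1417032209, 1417032208, 873625169, 1732579891, 1732579889, 1732579890, 1417031973, 1417031972,
  309736770, 1446277412, 1446277413, 355616370, 372405570, 1446277411, 846468449, 1417031977,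
  1446277410, 1446277657, 845616213, 1446277409, 1416044853, 1416044852, 308757810, 1984110936,
  561206855, 923952455, 1159948050, 844396050, 1918252057, 1697071897, 1730237493, 1918252055,
  1112938295, 1935024455, 591484535, 1097147251, 1159948049, 873625170, 923944290, 1935024453,
  928260452, 625031015, 1158899497, 1463050538, 1112938294, 1918252054, 1365517170, 1666654534,
  1918252056, 1633104938, 844396054, 390223415, 844396056, 1901474855, 641808215, 890402370,
  907167090, 560158534, 559113334, 593581174, 592537414, 559114050, 560157810, 372516218,
  641808214, 611411254, 628175974, 341996375, 611411255, 1159948056, 1159804532, 1130451578,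
  1948333414, 1965122614, 1696023335, 1964393258, 1159948054, 1984238133, 1984238132, 1981895730,
  1698898289, 594957333, 1698894457, 657741332, 1733571098, 1194464850, 891373175, 306598775,
  846614855, 1158821491, 1982022928, 1159820849, 389305890, 1197548371, 657741331, 1683169655,
  657741330, 354645575, 1733370695, 1651720536, 1982993735, 657741329, 1666454131, 1365717575,
  1175598455, 1919238928, 1919238929, 1919238931, 1919238930, 1462900290, 1197548372, 1663124853,
  1967333729, 874997009, 1415782771, 874997010, 588605255, 843538770, 557147255, 874997011,
  1399067255, 874997012, 1416045338, 1130697329, 1982022933, 1130701177, 1729246290, 1733571092,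
  1733571093, 1129738773, 1129738772, 1194464849, 1129738771, 588674130, 588597090, 1129738770,
  1733571097, 1129738769, 1982993733, 1129738537, 1733571090, 1733571091, 874600049, 1416041011,
  1733571089, 1733571088, 1416041009, 1416041010, 1733571095, 1902461730, 1733571094, 1949439571,
  1129738535, 306656615, 1733571096, 1933649495, 1410479730, 1982022929, 1982022930, 1984110930,
  1984110929, 1982022931, 1982022932, 843409173, 874997013, 1919238932, 1952523089, 1952523090,
  1129391972, 1635074613, 879891812, 1417024298, 1683427895, 1969300290, 1179853174, 1949439572,
  1951797818, 1160865578, 877795174, 929174614, 1731335494, 1176597815, 911479412, 911479413,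
  1665214298, 1176597814, 1733370693, 1982022937, 846483810, 559117415, 1699160377, 1164124530,
  929174615, 1982022936, 1982022935, 873948455, 1982022934, 1159820851, 1159820850, 592868369,
  1412568931, 592868375, 559302455, 1396778855, 1983140138, 1947350370, 1918120292, 1129453417,
  844525893, 1445152529, 592868377, 611718453, 1445152530, 1411867417, 1177687893, 611718452,
  373499730, 359867490, 1446123333, 1380151657, 1678914930, 1665214295, 324432935, 1681004371,
  1115050289, 1115050290, 1175598449, 1115050291, 309613410, 1416762212, 1095987815, 880153898,
  844394851, 1445152535, 1445033015, 843407731, 1446123335, 1444033655, 845498131, 1412568930,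
  1131827737, 1931560295, 1131827736, 1980904533, 1731481897, 305612375, 591730290, 1131827735,
  1131827734, 1731481895, 1947350371, 1900372530, 1410818850, 1410818851, 1410818849, 1131827728,
  1131827489, 1131827490, 594941250, 1131827491, 1131827492, 1192375649, 1131827493, 877733729,
  1731481893, 1731481891, 1731481892, 1731481889, 1731481890, 1731335490, 1696691250, 1445152534,
  1445033014, 1410818855, 895566458, 643044213, 643044212, 1445152536, 1462900294, 1197609815,
  1197609814, 1181881178, 1681004372, 1094017655, 879174938, 845498132, 1379164537, 1917149973,
  306668370, 1411867412, 1411867413, 1445152533, 1445152532, 845627729, 1445152531, 1695691893,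
  1918120290, 1918120291, 1366500455, 1176721175, 1729246295, 641955096, 1981895735, 1114059090,
  1114059089, 828712055, 1176721171, 610743572, 1176721173, 1680298778, 1176721172, 1094148692,
  1382494530, 610743576, 1460810855, 1634935895, 1649684850, 1919226935, 1113929495, 610743573,
  1647595897, 1648718612, 1648718613, 843538774, 1634943578, 1902330455, 1649881414, 1649677174,
  1382290290, 844394852, 1446277418, 1096165175, 1113920371, 1176721169, 1918251333, 1380325177,
  843407732, 1447240058, 1097152295, 1947350372, 1965122610, 1947620138, 1176721174, 1679250215,
  1126266454, 1410757178, 1931560294, 1981895734, 873625172, 1631941413, 1163997818, 1126258292,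
  1463050537, 323298930, 1463050535, 1110906455, 1631941170, 1400259094, 1400259096, 1679250211,
  1679250209, 1679250210, 1400259089, 1400259088, 1400258850, 326509890, 1400258851, 1463050533,
  1400258852, 1126266455, 1400258855, 338843250, 389178690, 873625171, 625153889, 1463050532,
  1400258853, 609302369, 1400258857, 1463050530, 1463050531, 907179333, 1463050529, 1916015974,
  1900372778, 1363632698, 1110906454, 1382297974, 1382486854, 1679250212, 1649873730, 1919226934,
  1113929494, 1110775412, 1179849338, 1631941415, 1679250213, 1651851574, 1648718614, 1651851575,
  1648718615, 1383481650, 1648718611, 641931089, 1383481651, 846483814, 1098200618, 1680298776,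
  391267175, 1098076772, 372393335, 641931090, 628298850, 1696691253, 907179335, 1176721170,
  1680298777, 628311577, 1918120289, 1665214291, 355951655, 1681004375, 1114059091, 907302695,
  355951650, 1948668694, 1948668695, 624387090, 624387091, 1412568935, 624387095, 1396778851,
  1649684849, 1936015658, 622094135, 1160849257, 1416762217, 924079658, 1165042535, 843538776,
  388326215, 1948668697, 638809415, 908351250, 1649881415, 1649677175, 1649881413, 1648695097,
  1382290291, 908351249, 1113920370, 1919238453, 1382299417, 907302693, 1665214292, 1197548378,
  1681004374, 1181819735, 1918243650, 1379145332, 911479418, 1363571495, 627131253, 1947620132,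
  1194680855, 1916015975, 1194680857, 1396778850, 1668629010, 1668359250, 638809413, 1194680609,
  1668629009, 1668629008, 1947620129, 1947620130, 1194680854, 1194680856, 1363571490, 1668628775,
  607213170, 321156695, 657548610, 605255251, 1668628773, 893523809, 1194680612, 1668628772,
  1668628771, 1194680613, 1668628777, 1194680610, 1194680611, 1098065249, 1947620131, 1380348690,
  1651851571, 1380348691, 910301009, 1383481655, 1380348695, 1899385415, 896668770, 640763255,
  910301010, 1948668696, 659637095, 828850775, 1698898290, 1164386617, 1465983813, 645088537,
  1416700769, 1097282131, 339174690, 1092970289, 607610129, 1683169651, 607610130, 321218375,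
  607610131, 1666454135, 1685136209, 1685136210, 1115050297, 1197548373, 607610137, 1967333730,
  1967333731, 1465983815, 1919107416, 1415782775, 925128211, 622032455, 925128210, 1931891737,
  1633104455, 1399067251, 925128209, 1633104453, 1130697330, 1732579897, 1412568934, 893478698,
  1396778852, 638867253, 1447240054, 1416041015, 1701913410, 845496693, 1984110932, 1984110931,
  1935020610, 1930843170, 1651852050, 1380348209, 1651852049, 925128208, 1466184216, 1108817255,
  321287250, 321210210, 1397125650, 1466184217, 1397125652, 1397125653, 1397125651, 927077969,
  879891811, 1397125655, 1466184214, 1466184215, 1635074850, 1683427890, 607213169, 1683427891,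
  1466184211, 1683427889, 1466184209, 1466184208, 1466184210, 913445973, 1397125409, 1397125657,
  1466184213, 1466184212, 392311890, 340932450, 1131488615, 1366704695, 1951797813, 1951797812,
  1914065970, 625043252, 907302698, 1108759415, 1916162375, 1466184218, 925128212, 623986295,
  927077970, 879891810, 592529255, 1164120697, 1931891733, 1164124529, 1092970291, 1931891735,
  1931891736, 1092970290, 1931891734, 845627735, 924079655, 1361278530, 1629701490, 1108767572,
  1678914933, 1901343330, 1948345651, 1097282130, 1097282129, 627520532, 1193498133, 625178133,
  1663521812, 1663521811, 1683169653, 1683169652, 1110925652, 1180115258, 1365717570, 1196826934,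
  1196826935, 1632907890, 1464017254, 1383482136, 627520533, 610603897, 625178132, 1665495578,
  358884215, 1898136930, 1967333732, 1092843090, 873617015, 895951173, 1379165969, 895951175,
  1126258291, 826700378, 1919107414, 1192449575, 1919107415, 1112764774, 1362392618, 1399067250,
  1464209977, 1679914292, 641808213, 1130697331, 1193498129, 1663124854, 1394701894, 1175614778,
  1678914932, 1192387895, 1379165976, 1917149492, 1948345650, 879173973, 1948345649, 1648718130,
  1383482129, 1193498128, 1648718129, 1380348214, 1383482134, 1666650690, 1662473250, 1108817254,
  1377264694, 1914004294, 1913927254, 1110794614, 1902461498, 1175672618, 1635074615, 1365721898,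
  1379165974, 1683427893, 1683427892, 1645696050, 1108686692, 1663137090, 1394689650, 1665495576,
  1913927255, 1366704690, 1665495574, 1197814055, 326378855, 611521891, 1665495575, 1665495571,
  658708049, 1665495330, 1197814057, 1665495329, 1665495577, 645076053, 1951797811, 1951797810,
  1092843089, 1197814291, 1951797809, 1197814288, 1197814290, 1197814289, 609302370, 1197814293,
  1197814292, 660681810, 1665495572, 1665495573, 1108759414, 1916162374, 1663521814, 1663521816,
  1361340210, 1629771575, 1114853732, 1182085418, 1663521815, 611521890, 324159335, 355616375,
  658708050, 609302371, 895750777, 1663521813, 895754609, 1197814298, 1193498132, 1679914293,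
  1663521817, 890402375, 1193498130, 879042935, 1193498131, 591881489, 1698898291, 1416700771,
  1416700770, 591881495, 1934889575, 1399985255, 1126524695, 1951605090, 1951605091, 591881497,
  1181819733, 1450255173, 1180115257, 1683169650, 1668420695, 323446055, 1685136211, 1108698929,
  1412507492, 877750058, 1396840294, 1668420694, 1447498295, 1415782774, 1733370690, 1464209978,
  927077972, 1729446693, 1177626458, 1399067252, 1399067253, 1125476132, 593581170, 592537410,
  1450255175, 1447240055, 846485011, 1126524697, 1984110933, 1125476129, 928256617, 1125476130,
  1685136212, 1125476131, 640763253, 1196630369, 1093030775, 1450455578, 846485012, 1179849337,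
  1916163093, 1179853169, 1108698931, 1108698930, 305558610, 305481570, 1093088615, 1450455576,
  1194403415, 1450455575, 1450455574, 1729446690, 1412854055, 927077971, 879891809, 1412854051,
  1412854292, 1412854293, 1450455573, 1450455572, 376583250, 356661090, 591484529, 1699156531,
  1699156530, 1699156529, 1450455571, 1450455570, 1450455569, 1450455568, 1412854297, 929174613,
  1412854049, 1450455337, 1412854050, 1729446695, 609314612, 1967526452, 1898337330, 1967526453,
  1981104938, 1126524694, 308573015, 561276215, 1126524696, 1698898293, 1698898292, 1732452695,
  1732452694, 1130828375, 643249176, 928391494, 342172530, 1363294055, 1949655338, 1112618857,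
  1108571730, 1913865570, 1951605092, 911679813, 826431095, 911679815, 1110529651, 1394894609,
  609449492, 1681224218, 374612855, 1093038932, 1645430130, 1377007170, 1631729495, 609449496,
  1916884535, 1464017255, 1114854935, 609449493, 1647793172, 1647793171, 1096971578, 1378973254,
  1647396214, 1113682774, 1394894616, 1098016055, 1113682775, 1917928294, 1916884534, 325211250,
  324167490, 1176581498, 641808212, 1130697332, 1130697333, 873886298, 1098077735, 1984110938,
  1393846055, 879173972, 879173971, 1631015975, 1631015973, 928260449, 641808211, 1899385898,
  1114854934, 1196626537, 1393846050, 1645500214, 1647793174, 1377068850, 1645500215, 1647793175,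
  625031011, 911479417, 1647793173, 911483249, 840255334, 840332374, 1376994934, 1645442374,
  828658298, 1394894614, 1444365098, 1461076775, 1097029418, 1092958052, 1629967410, 1699156533,
  1699156532, 1681224216, 1898198615, 1378961010, 1647408450, 1681223973, 1681223972, 1182085417,
  1681223970, 611521889, 1681223971, 1681223975, 658708051, 389293415, 625031010, 1182085653,
  1182085652, 644953170, 1681224217, 660804693, 1681223969, 1108571729, 1967526451, 1967526450,
  1967526449, 1182085651, 1182085650, 1182085649, 1182085648, 1182085655, 1182085654, 1461076770,
  1113674612, 1113674613, 1732579898, 658708052, 1984238135, 879042934, 391521090, 560416050,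
  1164386612, 1164386613, 592737810, 659960857, 1981895733, 1445413657, 309548615, 1732452696,
  1930585415, 1411606290, 1125283410, 1930577250, 1934893412, 928391493, 843142775, 928391495,
  1093817971, 1411606289, 1380005735, 1966367018, 1410557737, 659960855, 609621815, 659960856,
  911679814, 358884210, 659960854, 609621814, 592737814, 374813738, 592737816, 1900172855,
  391525415, 1648441175, 1662141810, 1393718850, 1464017257, 324302370, 828851490, 895951170,
  559367734, 558322534, 844195654, 845239414, 308499570, 307455810, 1630807418, 1648441174,
  1383150694, 1114727734, 1096971095, 1411606296, 1114727735, 1411462772, 878793338, 1193358694,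
  1461806134, 1444365095, 1461076778, 1411606294, 1732579893, 1732579892, 1730237490, 1410496052,
  307525170, 560281415, 593826935, 1411606291, 845628690, 879173970, 879173969, 1917019416,
  1461806135, 1917019417, 928260450, 928260451, 628298855, 1411606295, 829834538, 1917019414,
  1196626535, 1917019415, 1631810858, 845628694, 1900242215, 392504375, 845628696, 645076055,
  1951801657, 911483250, 561329734, 561275734, 1631737658, 1410557732, 558249334, 339093338,
  1164120692, 1164120693, 591730294, 341009018, 1096962932, 1444365093, 594941254, 645076054,
  324298538, 625153894, 1699156538, 591861332, 1967526455, 895754614, 374809410, 561395010,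
  1165373732, 1165373733, 1697935653, 1697935652, 1362249330, 1630696770, 594810209, 1697935651,
  1165373737, 1697935650, 1697935897, 593957973, 1697935649, 558184050, 339158615, 1948333415,
  1165373976, 1697935655, 591861331, 1165373975, 1165373974, 1444365090, 1125283409, 1984238131,
  1984238130, 1984238129, 1165373971, 1165373970, 1165373969, 1165373968]

theorem forall₂_certifies : List.Forall₂ (certifies · ·) solutions relabelings :=
  (List.all₂_eq_true _ _).mp (by decide +kernel)

set_option maxRecDepth 100000 in
theorem length_relabelings : relabelings.length = 2270 := by
  decide +kernel

theorem length_solutions : solutions.length = 2270 :=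
  forall₂_certifies.length_eq.trans length_relabelings

theorem exists_reps_of_mem_solutions {w : List (List ℕ)} (hw : w ∈ solutions) :
    ∃ v ∈ reps, RelabelRel 3 (Finset.Icc 1 7) (realize w) (realize v) := by
  obtain ⟨n, hn, rfl⟩ := List.getElem_of_mem hw
  have h := forall₂_certifies
  refine exists_relabelRel_of_certifies (h.get hn (h.length_eq ▸ hn)) fun i hi => ?_
  exact perm_of_mem_colorOrderings ((comp_of_mem_solutions hw).2 i hi).1

theorem isGCO_of_mem_solutions {w : List (List ℕ)} (hw : w ∈ solutions) : IsGCO (realize w) := by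
  obtain ⟨v, hv, h⟩ := exists_reps_of_mem_solutions hw
  exact (relabelRel_symm h).isGCO (isGCO_reps hv)

/-! ### Reduction to solutions -/

theorem Descends.congr {x y : ℕ → List ℕ} {p : ℕ × ℕ} (h : Descends x p)
    (hxy : ∀ i ∈ labels, DihEquiv (x i) (y i)) : Descends y p := by
  obtain ⟨b, hb, h⟩ := h
  refine ⟨b, hb, fun a ha => dihEquiv_trans (dihEquiv_symm ?_) (h a ha)⟩
  exact ((hxy a (mem_quint.mp ha).1.1).del _).del _

theorem exists_basePerm (b : List ℕ) : ∃ ρ : Equiv.Perm ℕ, b ∈ colorOrderings [1, 2, 3, 4, 5] →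
    (∀ x, x ∈ Finset.Icc 1 7 ↔ ρ x ∈ Finset.Icc 1 7) ∧ [1, 2, 3, 4, 5].map ρ = b ∧
      ρ 6 = 6 ∧ ρ 7 = 7 := by
  by_cases hb : b ∈ colorOrderings [1, 2, 3, 4, 5]
  · have hf : ∀ b ∈ colorOrderings [1, 2, 3, 4, 5], (∀ y ∈ labels, ∃ x ∈ labels,
        (b ++ [6, 7]).getD (x - 1) 0 = y) ∧ [1, 2, 3, 4, 5].map (fun x =>
          (b ++ [6, 7]).getD (x - 1) 0) = b ∧ (b ++ [6, 7]).getD 5 0 = 6 ∧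
            (b ++ [6, 7]).getD 6 0 = 7 := by decide +kernel
    obtain ⟨hs, h5, h6, h7⟩ := hf b hb
    simp only [mem_labels] at hs
    obtain ⟨ρ, hρ, hρf⟩ := exists_perm_of_surjOn hs
    refine ⟨ρ, fun _ => ⟨hρ, ?_, (hρf 6 (by decide)).trans h6, (hρf 7 (by decide)).trans h7⟩⟩
    have hle : ∀ x ∈ [1, 2, 3, 4, 5], x ∈ Finset.Icc 1 7 := by decide
    exact (List.map_congr_left fun x hx => hρf x (hle x hx)).trans h5
  · exact ⟨1, fun h => absurd h hb⟩

/-- A permutation of the labels that takes `[1, 2, 3, 4, 5]` to `b` and fixes `6` and `7`. -/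
noncomputable def basePerm (b : List ℕ) : Equiv.Perm ℕ := (exists_basePerm b).choose

theorem basePerm_spec {b : List ℕ} (hb : b ∈ colorOrderings [1, 2, 3, 4, 5]) :
    (∀ x, x ∈ Finset.Icc 1 7 ↔ basePerm b x ∈ Finset.Icc 1 7) ∧
      [1, 2, 3, 4, 5].map (basePerm b) = b ∧ basePerm b 6 = 6 ∧ basePerm b 7 = 7 :=
  (exists_basePerm b).choose_spec hb

theorem exists_solution {σ : Finset ℕ → List ℕ} (hσ : IsGCO σ) :
    ∃ b ∈ colorOrderings [1, 2, 3, 4, 5], ∃ w ∈ solutions, ∀ i ∈ labels,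
      DihEquiv (relabel (basePerm b) (realize w) {i}) (σ {i}) := by
  obtain ⟨b, hb, hbσ⟩ := (isGCO_iff.mp hσ).2 (6, 7) (by decide)
  change b ∈ colorOrderings [1, 2, 3, 4, 5] at hb
  obtain ⟨hρ, h5, h6, h7⟩ := basePerm_spec hb
  refine ⟨b, hb, ?_⟩
  set ρ := basePerm b
  have hτ := isGCO_iff.mp (RelabelRel.isGCO (relabelRel_relabel
    (fun x => (by simpa using (hρ (ρ.symm x)).symm)) 3 σ : RelabelRel _ _ _ (relabel ρ.symm σ)) hσ)
  have hrel (i : ℕ) : relabel ρ.symm σ {i} = (σ {ρ i}).map ρ.symm := by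
    conv_lhs => rw [← ρ.symm_apply_apply i]
    exact relabel_singleton ..
  have hne : ∀ i ∈ labels, del i labels ≠ [] := by decide
  have hx (i : ℕ) (hi : i ∈ labels) := canon_headD_mem (hne i hi) (hτ.1 i hi)
  set x : ℕ → List ℕ := fun i => canon ((del i labels).headD 0) (relabel ρ.symm σ {i})
  refine ⟨labels.map x, mem_solutions (fun i hi => (hx i hi).1) (fun i hi => ?_)
    fun p hp => (hτ.2 p hp).congr fun i hi => (hx i hi).2, fun i hi => ?_⟩
  · rw [agree, Bool.or_eq_true, decide_eq_true_iff]
    by_cases h : 5 < i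
    · exact .inl (by simpa [Nat.blt_eq] using h)
    right
    have hq : ∀ i ∈ labels, ¬ 5 < i → i ∈ [1, 2, 3, 4, 5] := by decide
    have hi5 := hq i hi h
    refine dihEquiv_trans (dihEquiv_symm (((hx i hi).2.del 6).del 7)) ?_
    have e6 : 6 = ρ.symm 6 := by rw [Equiv.eq_symm_apply, h6]
    have e7 : 7 = ρ.symm 7 := by rw [Equiv.eq_symm_apply, h7]
    have e5 : b.map ρ.symm = [1, 2, 3, 4, 5] := by simp [← h5]
    have d6 (l : List ℕ) : del 6 (l.map ρ.symm) = (del 6 l).map ρ.symm := by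
      conv_lhs => rw [e6, del_map]
    have d7 (l : List ℕ) : del 7 (l.map ρ.symm) = (del 7 l).map ρ.symm := by
      conv_lhs => rw [e7, del_map]
    rw [hrel, d6, d7, ← e5, ← ρ.symm_apply_apply i, del_map, ρ.symm_apply_apply]
    refine dihEquiv_map _ (hbσ _ ((perm_of_mem_colorOrderings hb).mem_iff.mp ?_))
    rw [← h5]
    exact List.mem_map_of_mem hi5
  · obtain ⟨j, rfl⟩ := ρ.surjective i
    have hj : j ∈ labels := by rw [mem_labels] at hi ⊢; exact (hρ j).mpr hi
    rw [relabel_singleton, realize_singleton, comp_map j hj]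
    have e : (relabel ρ.symm σ {j}).map ρ = σ {ρ j} := by rw [hrel]; simp
    rw [← e]
    exact dihEquiv_map ρ (dihEquiv_symm (hx j hj).2)

theorem eq_of_dihEquiv_relabel {b b' : List ℕ} (hb : b ∈ colorOrderings [1, 2, 3, 4, 5])
    (hb' : b' ∈ colorOrderings [1, 2, 3, 4, 5]) {w w' : List (List ℕ)} (hw : w ∈ solutions)
    (hw' : w' ∈ solutions)
    (h : ∀ i ∈ labels, DihEquiv (relabel (basePerm b) (realize w) {i})
      (relabel (basePerm b') (realize w') {i})) : b = b' ∧ w = w' := by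
  have key {b : List ℕ} (hb : b ∈ colorOrderings [1, 2, 3, 4, 5]) {w : List (List ℕ)}
      (hw : w ∈ solutions) (a : ℕ) (ha : a ∈ [1, 2, 3, 4, 5]) :
      DihEquiv (del 7 (del 6 (relabel (basePerm b) (realize w) {a}))) (del a b) := by
    obtain ⟨-, h5, h6, h7⟩ := basePerm_spec hb
    rw [← (perm_of_mem_colorOrderings hb).mem_iff, ← h5] at ha
    obtain ⟨i, hi, rfl⟩ := List.mem_map.mp ha
    have hl : ∀ i ∈ [1, 2, 3, 4, 5], i ∈ labels ∧ ¬ 5 < i := by decide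
    have hagree := ((comp_of_mem_solutions hw).2 i (hl i hi).1).2
    rw [agree, Bool.or_eq_true, decide_eq_true_iff, Nat.blt_eq] at hagree
    have := dihEquiv_map (basePerm b) (hagree.resolve_left (hl i hi).2)
    rwa [← del_map, ← del_map, ← del_map, h5, h6, h7, ← realize_singleton,
      ← relabel_singleton] at this
  have hbb : ∀ b ∈ colorOrderings [1, 2, 3, 4, 5], ∀ b' ∈ colorOrderings [1, 2, 3, 4, 5],
      (∀ a ∈ [1, 2, 3, 4, 5], DihEquiv (del a b) (del a b')) → b = b' := by decide +kernel
  have hl : ∀ i ∈ [1, 2, 3, 4, 5], i ∈ labels := by decide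
  obtain rfl : b = b' := hbb b hb b' hb' fun a ha =>
    dihEquiv_trans (dihEquiv_symm (key hb hw a ha))
      (dihEquiv_trans (((h a (hl a ha)).del 6).del 7) (key hb' hw' a ha))
  refine ⟨rfl, ?_⟩
  obtain ⟨hlen, hw⟩ := comp_of_mem_solutions hw
  obtain ⟨hlen', hw'⟩ := comp_of_mem_solutions hw'
  rw [← map_comp_of_length hlen, ← map_comp_of_length hlen']
  refine List.map_congr_left fun i hi => ?_
  refine DihEquiv.eq_of_mem_colorOrderings (.filter _ (by decide)) (hw i hi).1 (hw' i hi).1 ?_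
  have hi' : basePerm b i ∈ labels := by
    rw [mem_labels] at hi ⊢
    exact ((basePerm_spec hb).1 i).mp hi
  have := dihEquiv_map (basePerm b).symm (h _ hi')
  rw [relabel_singleton, relabel_singleton] at this
  simpa [realize_singleton] using this

theorem isGCO_relabel_basePerm {b : List ℕ} (hb : b ∈ colorOrderings [1, 2, 3, 4, 5])
    {w : List (List ℕ)} (hw : w ∈ solutions) : IsGCO (relabel (basePerm b) (realize w)) :=
  (relabelRel_relabel (basePerm_spec hb).1 3 _).isGCO (isGCO_of_mem_solutions hw)

theorem List.Nodup.natCard_eq_length {α : Type*} {l : List α} (h : l.Nodup) :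
    Nat.card {x // x ∈ l} = l.length := by
  classical
  rw [Nat.subtype_card l.toFinset fun x => List.mem_toFinset, List.toFinset_card_of_nodup h]

theorem natCard_gco : Nat.card (Quotient (gcoSetoid 3 (Finset.Icc 1 7) IsGCO)) = 27240 := by
  let Φ (q : {b // b ∈ colorOrderings [1, 2, 3, 4, 5]} × {w // w ∈ solutions}) :
      Quotient (gcoSetoid 3 (Finset.Icc 1 7) IsGCO) :=
    Quotient.mk _ ⟨_, isGCO_relabel_basePerm q.1.2 q.2.2⟩
  have hΦ : Function.Bijective Φ := by
    constructor
    · rintro ⟨⟨b, hb⟩, ⟨w, hw⟩⟩ ⟨⟨b', hb'⟩, ⟨w', hw'⟩⟩ h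
      have h := forall_subset_card_one.mp (Quotient.exact h)
      simp only [← mem_labels] at h
      obtain ⟨rfl, rfl⟩ := eq_of_dihEquiv_relabel hb hb' hw hw' h
      rfl
    · rintro ⟨σ, hσ⟩
      obtain ⟨b, hb, w, hw, h⟩ := exists_solution hσ
      simp only [mem_labels] at h
      exact ⟨⟨⟨b, hb⟩, ⟨w, hw⟩⟩, Quotient.sound (forall_subset_card_one.mpr h)⟩
  have h12 : (colorOrderings [1, 2, 3, 4, 5]).length = 12 :=
    length_colorOrderings_quint (6, 7) (by decide)
  rw [← Nat.card_congr (Equiv.ofBijective Φ hΦ), Nat.card_prod,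
    (nodup_colorOrderings (by decide)).natCard_eq_length, nodup_solutions.natCard_eq_length,
    length_solutions, h12]

/-! ### An invariant of relabeling orbits -/

/-- The letters `b` and `c` are adjacent in a cyclic word. -/
def Adjacent (l : List ℕ) (b c : ℕ) : Prop := ∃ t, DihEquiv l (b :: c :: t)

instance (l : List ℕ) (b c : ℕ) : Decidable (Adjacent l b c) :=
  decidable_of_iff (∃ l' ∈ dihedralWords l, l'.take 2 = [b, c]) <| by
    simp only [mem_dihedralWords]
    constructor
    · rintro ⟨l', h, h'⟩
      refine ⟨l'.drop 2, ?_⟩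
      rw [← List.take_append_drop 2 l', h'] at h
      exact h
    · rintro ⟨t, h⟩
      exact ⟨_, h, rfl⟩

theorem Adjacent.congr {l l' : List ℕ} {b c : ℕ} (h : Adjacent l b c) (hl : DihEquiv l l') :
    Adjacent l' b c :=
  h.imp fun _ => dihEquiv_trans (dihEquiv_symm hl)

theorem Adjacent.map {l : List ℕ} {b c : ℕ} (h : Adjacent l b c) (f : ℕ → ℕ) :
    Adjacent (l.map f) (f b) (f c) :=
  h.imp' (List.map f) fun _ => dihEquiv_map f

/-- The triples of labels `a, b, c` such that `b` and `c` are adjacent in the component at `a`. -/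
def adjacentTriples (w : List (List ℕ)) : List (ℕ × ℕ × ℕ) :=
  (labels ×ˢ labels ×ˢ labels).filter fun t => Adjacent (comp w t.1) t.2.1 t.2.2

/-- The number of quadruples of labels `a, b, c, d` such that `b` is adjacent to `c` and `d` in
the component at `a`, and to `d` in the component at `c`. -/
def invariant (w : List (List ℕ)) : ℕ :=
  ((adjacentTriples w ×ˢ labels).filter fun q => Adjacent (comp w q.1.1) q.1.2.1 q.2 ∧
    Adjacent (comp w q.1.2.2) q.1.2.1 q.2).length

theorem invariant_le_of_relabelRel {v w : List (List ℕ)}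
    (h : RelabelRel 3 (Finset.Icc 1 7) (realize v) (realize w)) : invariant v ≤ invariant w := by
  obtain ⟨ρ, hρ, h⟩ := h
  replace h := forall_subset_card_one.mp h
  have hadj {a b c : ℕ} (ha : a ∈ labels) (habc : Adjacent (comp v a) b c) :
      Adjacent (comp w (ρ a)) (ρ b) (ρ c) := by
    have : DihEquiv (relabel ρ (realize v) {ρ a}) _ := h (ρ a) ((hρ a).mp (mem_labels.mp ha))
    rw [relabel_singleton, realize_singleton, realize_singleton] at this
    exact (habc.map ρ).congr this
  have hmem {x : ℕ} (hx : x ∈ labels) : ρ x ∈ labels := by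
    rw [mem_labels] at hx ⊢
    exact (hρ x).mp hx
  have hn : labels.Nodup := by decide
  have hnt : (adjacentTriples v).Nodup := (hn.product (hn.product hn)).filter _
  let f : (ℕ × ℕ × ℕ) × ℕ → (ℕ × ℕ × ℕ) × ℕ := Prod.map (Prod.map ρ (Prod.map ρ ρ)) ρ
  have hf : Function.Injective f :=
    (ρ.injective.prodMap (ρ.injective.prodMap ρ.injective)).prodMap ρ.injective
  unfold invariant
  rw [← List.length_map f]
  refine (List.subperm_of_subset (((hnt.product hn).filter _).map hf) fun q hq => ?_).length_le
  obtain ⟨⟨⟨a, b, c⟩, d⟩, h, rfl⟩ := List.mem_map.mp hq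
  obtain ⟨h, h'⟩ := List.mem_filter.mp h
  obtain ⟨h, hd⟩ := List.pair_mem_product.mp h
  obtain ⟨h, h1⟩ := List.mem_filter.mp h
  obtain ⟨ha, h⟩ := List.pair_mem_product.mp h
  obtain ⟨hb, hc⟩ := List.pair_mem_product.mp h
  obtain ⟨h2, h3⟩ := of_decide_eq_true h'
  refine List.mem_filter.mpr ⟨List.pair_mem_product.mpr ⟨List.mem_filter.mpr
    ⟨List.pair_mem_product.mpr ⟨hmem ha, List.pair_mem_product.mpr ⟨hmem hb, hmem hc⟩⟩, ?_⟩,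
      hmem hd⟩, ?_⟩
  · exact decide_eq_true (hadj ha (of_decide_eq_true h1))
  · exact decide_eq_true ⟨hadj ha h2, hadj hc h3⟩

set_option maxRecDepth 100000 in
theorem nodup_map_invariant_reps : (reps.map invariant).Nodup := by
  decide +kernel

theorem natCard_gco_orbits :
    Nat.card (Quotient (gcoOrbitSetoid 3 (Finset.Icc 1 7) IsGCO)) = 11 := by
  let Ψ (v : {v // v ∈ reps}) : Quotient (gcoOrbitSetoid 3 (Finset.Icc 1 7) IsGCO) :=
    Quotient.mk _ ⟨_, isGCO_reps v.2⟩
  have hΨ : Function.Bijective Ψ := by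
    constructor
    · rintro ⟨v, hv⟩ ⟨v', hv'⟩ h
      have h : RelabelRel _ _ _ _ := Quotient.exact h
      exact Subtype.ext (List.inj_on_of_nodup_map nodup_map_invariant_reps hv hv'
        ((invariant_le_of_relabelRel h).antisymm
          (invariant_le_of_relabelRel (relabelRel_symm h))))
    · rintro ⟨σ, hσ⟩
      obtain ⟨b, hb, w, hw, h⟩ := exists_solution hσ
      simp only [mem_labels] at h
      obtain ⟨v, hv, hvw⟩ := exists_reps_of_mem_solutions hw
      have hr : RelabelRel 3 (Finset.Icc 1 7) (relabel (basePerm b) (realize w)) σ :=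
        ⟨Equiv.refl ℕ, fun _ => Iff.rfl, forall_subset_card_one.mpr fun i hi => by
          simpa [relabel] using h i hi⟩
      exact ⟨⟨v, hv⟩, Quotient.sound (relabelRel_trans (relabelRel_symm hvw)
        (relabelRel_trans (relabelRel_relabel (basePerm_spec hb).1 3 _) hr))⟩
  rw [← Nat.card_congr (Equiv.ofBijective Ψ hΨ),
    nodup_map_invariant_reps.of_map.natCard_eq_length]
  rfl

/-- There are exactly 27240 `(3,7)` pseudo-GCOs on the label set `{1, …, 7}`, and the
relabeling action of the symmetric group `S₇` on them has exactly 11 orbits. -/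
theorem card_pseudoGCO_three_seven :
    Nat.card (Quotient (gcoSetoid 3 (Finset.Icc 1 7) (fun σ =>
        IsPreGCO 3 (Finset.Icc 1 7) σ ∧ IsPseudoGCO 3 (Finset.Icc 1 7) σ))) = 27240 ∧
    Nat.card (Quotient (gcoOrbitSetoid 3 (Finset.Icc 1 7) (fun σ =>
        IsPreGCO 3 (Finset.Icc 1 7) σ ∧ IsPseudoGCO 3 (Finset.Icc 1 7) σ))) = 11 := by
  exact ⟨natCard_gco, natCard_gco_orbits⟩
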